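/- arXiv:2408.09059 — 3 statements merged into one kernel-verified Lean document; each statement's English description precedes it below -/
import Mathlib

section
/- Let G be a planar graph and suppose F(G) contains a clique on 3 vertices corresponding to three pairwise vertex-disjoint edges of G. Then G contains a subgraph isomorphic to C_3 □ K_2 (the triangular prism) in which the three given edges are the three connector edges between the two triangles. -/
open SimpleGraph

variable {V : Type*}

/-- Four distinct vertices forming a 4-cycle in `G`. -/
def IsC4 (G : SimpleGraph V) (a b c d : V) : Prop :=
  a ≠ b ∧ a ≠ c ∧ a ≠ d ∧ b ≠ c ∧ b ≠ d ∧ c ≠ d ∧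
    G.Adj a b ∧ G.Adj b c ∧ G.Adj c d ∧ G.Adj d a

/-- A proper edge coloring of `G` in which every 4-cycle is rainbow. -/
def IsBColoring (G : SimpleGraph V) {α : Type*} (C : Sym2 V → α) : Prop :=
  (∀ a b c : V, G.Adj a b → G.Adj a c → b ≠ c → C s(a, b) ≠ C s(a, c)) ∧
  (∀ a b c d : V, IsC4 G a b c d →
    C s(a, b) ≠ C s(b, c) ∧ C s(a, b) ≠ C s(c, d) ∧ C s(a, b) ≠ C s(d, a) ∧
    C s(b, c) ≠ C s(c, d) ∧ C s(b, c) ≠ C s(d, a) ∧ C s(c, d) ≠ C s(d, a))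

/-- The minimum number of colors in a B-coloring of `G`. -/
noncomputable def qB (G : SimpleGraph V) : ℕ :=
  sInf {n | ∃ C : Sym2 V → Fin n, IsBColoring G C}

/-- `e` and `f` are opposite edges of some 4-cycle of `G`. -/
def OppC4 (G : SimpleGraph V) (e f : Sym2 V) : Prop :=
  ∃ a b c d : V, IsC4 G a b c d ∧ e = s(a, b) ∧ f = s(c, d)

/-- Two edges (as unordered pairs) share no vertex. -/
def EdgeDisjoint (e f : Sym2 V) : Prop := ∀ v : V, v ∈ e → v ∉ f

/-- The graph `F(G)` on the edges of `G`: two vertex-disjoint edges are adjacent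
iff they are opposite edges of a 4-cycle of `G`. -/
def Fgraph (G : SimpleGraph V) : SimpleGraph G.edgeSet :=
  SimpleGraph.fromRel fun e f =>
    EdgeDisjoint (e : Sym2 V) (f : Sym2 V) ∧ OppC4 G (e : Sym2 V) (f : Sym2 V)

/-- The extended line graph `L⁺(G)`: edges of `G` are adjacent if they share an
endpoint or are opposite edges of a 4-cycle of `G`. -/
def Lplus (G : SimpleGraph V) : SimpleGraph G.edgeSet :=
  SimpleGraph.fromRel fun e f =>
    (∃ v : V, v ∈ (e : Sym2 V) ∧ v ∈ (f : Sym2 V)) ∨ OppC4 G (e : Sym2 V) (f : Sym2 V)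

/-- `H` is a minor of `G`, via branch sets. -/
def HasMinor {W : Type*} (G : SimpleGraph V) (H : SimpleGraph W) : Prop :=
  ∃ B : W → Set V,
    (∀ w, (G.induce (B w)).Connected) ∧
    (∀ w₁ w₂, w₁ ≠ w₂ → Disjoint (B w₁) (B w₂)) ∧
    (∀ w₁ w₂, H.Adj w₁ w₂ → ∃ v₁ ∈ B w₁, ∃ v₂ ∈ B w₂, G.Adj v₁ v₂)

/-- Planarity via Wagner's theorem: no `K₅` minor and no `K₃,₃` minor. -/
def IsPlanar (G : SimpleGraph V) : Prop :=
  ¬ HasMinor G (completeGraph (Fin 5)) ∧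
    ¬ HasMinor G (completeBipartiteGraph (Fin 3) (Fin 3))

/-- Outerplanarity: no `K₄` minor and no `K₂,₃` minor. -/
def IsOuterplanar (G : SimpleGraph V) : Prop :=
  ¬ HasMinor G (completeGraph (Fin 4)) ∧
    ¬ HasMinor G (completeBipartiteGraph (Fin 2) (Fin 3))

/-- `G` is 2-connected: at least 3 vertices and removing any vertex leaves it connected. -/
def IsTwoConnected (G : SimpleGraph V) : Prop :=
  3 ≤ Nat.card V ∧ ∀ v : V, (G.induce {u | u ≠ v}).Connected

/-- `K₄` minus one edge, on `Fin 4` (the edge between `2` and `3` removed). -/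
def K4e : SimpleGraph (Fin 4) :=
  SimpleGraph.fromRel fun x y => s(x, y) ≠ s((2 : Fin 4), (3 : Fin 4))

/-- The chromatic index: minimum number of colors in a proper edge coloring. -/
noncomputable def chromIndex (G : SimpleGraph V) : ℕ :=
  sInf {n | ∃ C : Sym2 V → Fin n,
    ∀ a b c : V, G.Adj a b → G.Adj a c → b ≠ c → C s(a, b) ≠ C s(a, c)}

/-- `K₆` minus a perfect matching, on `Fin 6` (the matching `01, 23, 45` removed). -/
def K6mM : SimpleGraph (Fin 6) :=
  SimpleGraph.fromRel fun x y => (x : ℕ) / 2 ≠ (y : ℕ) / 2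

/-- A path `v₀v₁v₂v₃` together with a vertex `4` adjacent to all four path vertices. -/
def FanGraph : SimpleGraph (Fin 5) :=
  SimpleGraph.fromRel fun x y =>
    ((x : ℕ) + 1 = (y : ℕ) ∧ (y : ℕ) ≤ 3) ∨ (x : ℕ) = 4


/-- An injective graph homomorphism exhibits its source as a minor of its target. -/
theorem HasMinor.of_injective_hom {V W : Type*} {G : SimpleGraph V} {H : SimpleGraph W}
    (f : H →g G) (hf : Function.Injective f) : HasMinor G H := by
  refine ⟨fun w => {f w}, fun w => ?_, fun w₁ w₂ h => ?_, fun w₁ w₂ h => ?_⟩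
  · exact { preconnected := SimpleGraph.Preconnected.of_subsingleton }
  · exact Set.disjoint_singleton.mpr (hf.ne h)
  · exact ⟨f w₁, rfl, f w₂, rfl, f.map_adj h⟩

/-- Two disjoint triples of vertices, completely joined to each other, give a `K₃,₃` minor. -/
theorem HasMinor.completeBipartiteGraph_of_adj {V α β : Type*} {G : SimpleGraph V}
    {x : α → V} {y : β → V} (hx : Function.Injective x) (hy : Function.Injective y)
    (h : ∀ i j, G.Adj (x i) (y j)) : HasMinor G (completeBipartiteGraph α β) := by
  refine HasMinor.of_injective_hom ⟨Sum.elim x y, ?_⟩ ?_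
  · rintro (i | i) (j | j) hij <;> simp at hij
    · exact h i j
    · exact (h j i).symm
  · exact hx.sumElim hy fun i j => (h i j).ne

/-- The vertices of the second edge of an `OppC4` pair can be named so as to match
a given naming of the first. -/
theorem OppC4.exists_matching {V : Type*} {G : SimpleGraph V} {u v : V} {f : Sym2 V}
    (h : OppC4 G s(u, v) f) :
    ∃ x y : V, f = s(x, y) ∧ G.Adj u x ∧ G.Adj v y := by
  obtain ⟨a, b, c, d, ⟨-, -, -, -, -, -, -, hbc, -, hda⟩, he, rfl⟩ := h
  rcases Sym2.eq_iff.mp he with ⟨rfl, rfl⟩ | ⟨rfl, rfl⟩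
  · exact ⟨d, c, Sym2.eq_swap, hda.symm, hbc⟩
  · exact ⟨c, d, rfl, hbc, hda.symm⟩

theorem prism_of_triangle_in_Fgraph {V : Type*} [Fintype V] (G : SimpleGraph V)
    (hG : IsPlanar G) (e : Fin 3 → Sym2 V) (he : ∀ i, e i ∈ G.edgeSet)
    (hdisj : ∀ i j, i ≠ j → EdgeDisjoint (e i) (e j))
    (hopp : ∀ i j, i ≠ j → OppC4 G (e i) (e j)) :
    ∃ u v : Fin 3 → V,
      Function.Injective (Sum.elim u v) ∧
      (∀ i, e i = s(u i, v i)) ∧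
      (∀ i, G.Adj (u i) (v i)) ∧
      (∀ i j, i ≠ j → G.Adj (u i) (u j)) ∧
      (∀ i j, i ≠ j → G.Adj (v i) (v j)) := by
  obtain ⟨u₀, v₀, h₀⟩ : ∃ a b, e 0 = s(a, b) := ⟨_, _, (Quot.out_eq (e 0)).symm⟩
  obtain ⟨u₁, v₁, h₁, hu₀₁, hv₀₁⟩ := (h₀ ▸ hopp 0 1 (by decide)).exists_matching
  obtain ⟨u₂, v₂, h₂, hu₀₂, hv₀₂⟩ := (h₀ ▸ hopp 0 2 (by decide)).exists_matching
  obtain ⟨x, y, hxy, hux, hvy⟩ := (h₁ ▸ hopp 1 2 (by decide)).exists_matching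
  have ha₀ : G.Adj u₀ v₀ := by simpa [h₀] using he 0
  have ha₁ : G.Adj u₁ v₁ := by simpa [h₁] using he 1
  have ha₂ : G.Adj u₂ v₂ := by simpa [h₂] using he 2
  have hd₀₁ := hdisj 0 1 (by decide)
  have hd₀₂ := hdisj 0 2 (by decide)
  have hd₁₂ := hdisj 1 2 (by decide)
  simp only [h₀, h₁, h₂, EdgeDisjoint, Sym2.mem_iff, forall_eq_or_imp, forall_eq, not_or]
    at hd₀₁ hd₀₂ hd₁₂
  rcases Sym2.eq_iff.mp (h₂.symm.trans hxy) with ⟨rfl, rfl⟩ | ⟨rfl, rfl⟩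
  · refine ⟨![u₀, u₁, u₂], ![v₀, v₁, v₂], ?_, ?_, ?_, ?_, ?_⟩
    · have := ha₀.ne
      have := ha₁.ne
      have := ha₂.ne
      refine Function.Injective.sumElim ?_ ?_ ?_
      · intro i j; fin_cases i <;> fin_cases j <;> simp <;> grind
      · intro i j; fin_cases i <;> fin_cases j <;> simp <;> grind
      · intro i j; fin_cases i <;> fin_cases j <;> simp <;> grind
    · simp [Fin.forall_fin_succ, h₀, h₁, h₂]
    · simp [Fin.forall_fin_succ, ha₀, ha₁, ha₂]
    · simp [Fin.forall_fin_succ, hu₀₁, hu₀₂, hux, hu₀₁.symm, hu₀₂.symm, hux.symm]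
    · simp [Fin.forall_fin_succ, hv₀₁, hv₀₂, hvy, hv₀₁.symm, hv₀₂.symm, hvy.symm]
  · refine absurd (HasMinor.completeBipartiteGraph_of_adj
      (x := ![u₀, v₁, v₂]) (y := ![v₀, u₁, u₂]) ?_ ?_ ?_) hG.2
    · intro i j; fin_cases i <;> fin_cases j <;> simp <;> grind
    · intro i j; fin_cases i <;> fin_cases j <;> simp <;> grind
    · simp [Fin.forall_fin_succ, ha₀, hu₀₁, hu₀₂, hv₀₁.symm, hv₀₂.symm, ha₁.symm, ha₂.symm,
        hux.symm, hvy]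
end

section
/- Every planar graph G with maximum degree at most Δ satisfies q_B(G) ≤ 2Δ + 8. -/
open SimpleGraph

variable {V : Type*}

section Minors

variable {W : Type*} {G G' : SimpleGraph V} {H : SimpleGraph W}

lemma HasMinor.mono (hle : G ≤ G') (h : HasMinor G H) : HasMinor G' H := by
  obtain ⟨B, hB, hd, ha⟩ := h
  refine ⟨B, fun w => (hB w).mono fun _ _ hxy => hle hxy, hd, fun w₁ w₂ h => ?_⟩
  obtain ⟨x, hx, y, hy, hxy⟩ := ha w₁ w₂ h
  exact ⟨x, hx, y, hy, hle hxy⟩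

lemma IsPlanar.anti (hle : G ≤ G') (h : IsPlanar G') : IsPlanar G :=
  ⟨fun h' => h.1 (h'.mono hle), fun h' => h.2 (h'.mono hle)⟩

lemma connected_induce_singleton (G : SimpleGraph V) (v : V) :
    (G.induce ({v} : Set V)).Connected :=
  Connected.of_subsingleton

lemma hasMinor_K5 (a : Fin 4 → V) (T : Set V) (hT : (G.induce T).Connected)
    (ha : ∀ i j, i ≠ j → G.Adj (a i) (a j)) (haT : ∀ i, a i ∉ T)
    (hadj : ∀ i, ∃ t ∈ T, G.Adj (a i) t) : HasMinor G (completeGraph (Fin 5)) := by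
  refine ⟨Fin.cons T fun i => {a i}, fun w => ?_, fun w₁ w₂ h => ?_, fun w₁ w₂ h => ?_⟩
  · induction w using Fin.cases with
    | zero => exact hT
    | succ i => exact connected_induce_singleton G (a i)
  · induction w₁ using Fin.cases with
    | zero =>
      induction w₂ using Fin.cases with
      | zero => exact absurd rfl h
      | succ j => simpa using haT j
    | succ i =>
      induction w₂ using Fin.cases with
      | zero => simpa using haT i
      | succ j => simpa using (ha i j (by simpa using h)).ne
  · induction w₁ using Fin.cases with
    | zero =>
      induction w₂ using Fin.cases with
      | zero => exact absurd rfl h.ne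
      | succ j =>
        obtain ⟨t, ht, h'⟩ := hadj j
        exact ⟨t, ht, a j, rfl, h'.symm⟩
    | succ i =>
      induction w₂ using Fin.cases with
      | zero =>
        obtain ⟨t, ht, h'⟩ := hadj i
        exact ⟨a i, rfl, t, ht, h'⟩
      | succ j => exact ⟨a i, rfl, a j, rfl, ha i j (by simpa using h.ne)⟩

lemma hasMinor_K33 (a : Fin 3 → V) (b : Fin 2 → V) (T : Set V) (hT : (G.induce T).Connected)
    (ha : a.Injective) (hb : b.Injective) (haT : ∀ i, a i ∉ T) (hbT : ∀ i, b i ∉ T)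
    (hab : ∀ i j, G.Adj (a i) (b j)) (hadj : ∀ i, ∃ t ∈ T, G.Adj (a i) t) :
    HasMinor G (completeBipartiteGraph (Fin 3) (Fin 3)) := by
  have hne : ∀ i j, a i ≠ b j := fun i j => (hab i j).ne
  refine ⟨Sum.elim (fun i => {a i}) (Fin.cons T fun j => {b j}), fun w => ?_, fun w₁ w₂ h => ?_,
    fun w₁ w₂ h => ?_⟩
  · rcases w with i | i
    · exact connected_induce_singleton G (a i)
    · induction i using Fin.cases with
      | zero => exact hT
      | succ j => exact connected_induce_singleton G (b j)
  · rcases w₁ with i | i <;> rcases w₂ with j | j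
    · simpa using ha.ne (by simpa using h)
    · induction j using Fin.cases with
      | zero => simpa using haT i
      | succ j => simpa using hne i j
    · induction i using Fin.cases with
      | zero => simpa using haT j
      | succ i => simpa using (hne j i).symm
    · induction i using Fin.cases with
      | zero =>
        induction j using Fin.cases with
        | zero => exact absurd rfl h
        | succ j => simpa using hbT j
      | succ i =>
        induction j using Fin.cases with
        | zero => simpa using hbT i
        | succ j => simpa using hb.ne (by simpa using h)
  · have key : ∀ i (j : Fin 3), ∃ y ∈ (Fin.cons T fun j => {b j} : Fin 3 → Set V) j,
        G.Adj (a i) y := by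
      intro i j
      induction j using Fin.cases with
      | zero => exact hadj i
      | succ j => exact ⟨b j, rfl, hab i j⟩
    rcases w₁ with i | i <;> rcases w₂ with j | j
    · simp at h
    · obtain ⟨y, hy, h'⟩ := key i j
      exact ⟨a i, rfl, y, hy, h'⟩
    · obtain ⟨y, hy, h'⟩ := key j i
      exact ⟨y, hy, a j, rfl, h'.symm⟩
    · simp at h

/-- The graph obtained from `G` by merging `b` into `a`, keeping `b` as an isolated vertex. -/
def mergeInto (G : SimpleGraph V) (a b : V) : SimpleGraph V where
  Adj x y := x ≠ y ∧ x ≠ b ∧ y ≠ b ∧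
    (G.Adj x y ∨ (x = a ∧ G.Adj b y) ∨ (y = a ∧ G.Adj b x))
  symm := ⟨by
    rintro x y ⟨h₁, h₂, h₃, h₄⟩
    exact ⟨h₁.symm, h₃, h₂, by rw [G.adj_comm y x]; tauto⟩⟩
  loopless := ⟨fun _ h => h.1 rfl⟩

lemma HasMinor.of_mergeInto {a b : V} (hab : G.Adj a b) (hH : ∀ w, ∃ w', H.Adj w w')
    (h : HasMinor (mergeInto G a b) H) : HasMinor G H := by
  classical
  obtain ⟨B, hB, hd, ha⟩ := h
  have hb : ∀ w, b ∉ B w := by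
    intro w hw
    obtain ⟨w', hw'⟩ := hH w
    obtain ⟨x, hx, y, -, hxy⟩ := ha w w' hw'
    obtain ⟨p⟩ := (hB w).preconnected ⟨b, hw⟩ ⟨x, hx⟩
    cases p with
    | nil => exact hxy.2.1 rfl
    | cons h _ => exact h.2.1 rfl
  refine ⟨fun w => if a ∈ B w then insert b (B w) else B w, fun w => ?_, fun w₁ w₂ h => ?_,
    fun w₁ w₂ h => ?_⟩
  · by_cases haw : a ∈ B w
    · show (G.induce (if a ∈ B w then insert b (B w) else B w)).Connected
      rw [if_pos haw]
      have hba : (G.induce (insert b (B w))).Adj ⟨b, Or.inl rfl⟩ ⟨a, Or.inr haw⟩ := hab.symm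
      have step : ∀ x y : B w, ((mergeInto G a b).induce (B w)).Reachable x y →
          (G.induce (insert b (B w))).Reachable ⟨x, Or.inr x.2⟩ ⟨y, Or.inr y.2⟩ := by
        rintro x y ⟨p⟩
        induction p with
        | nil => exact Reachable.refl _
        | @cons x y z hxy p ih =>
          refine Reachable.trans ?_ ih
          obtain ⟨-, -, -, h | ⟨h, h'⟩ | ⟨h, h'⟩⟩ := hxy
          · exact Adj.reachable (G := G.induce (insert b (B w))) h
          · have e : x = ⟨a, haw⟩ := Subtype.ext h
            subst e
            exact hba.symm.reachable.trans
              (Adj.reachable (G := G.induce (insert b (B w))) h')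
          · have e : y = ⟨a, haw⟩ := Subtype.ext h
            subst e
            exact Reachable.trans
              (Adj.reachable (G := G.induce (insert b (B w))) (u := ⟨b, Or.inl rfl⟩)
                (v := ⟨x, Or.inr x.2⟩) h').symm hba.reachable
      rw [connected_iff_exists_forall_reachable]
      refine ⟨⟨a, Or.inr haw⟩, ?_⟩
      rintro ⟨x, rfl | hx⟩
      · exact hba.symm.reachable
      · exact step ⟨a, haw⟩ ⟨x, hx⟩ ((hB w).preconnected _ _)
    · show (G.induce (if a ∈ B w then insert b (B w) else B w)).Connected
      rw [if_neg haw]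
      refine (hB w).mono ?_
      rintro x y ⟨-, -, -, h | ⟨h, -⟩ | ⟨h, -⟩⟩
      · exact h
      · exact absurd (h ▸ x.2) haw
      · exact absurd (h ▸ y.2) haw
  · have hdis := hd w₁ w₂ h
    by_cases h₁ : a ∈ B w₁ <;> by_cases h₂ : a ∈ B w₂
    · exact absurd h₂ (Set.disjoint_left.1 hdis h₁)
    · simpa [h₁, h₂, hb] using hdis
    · simpa [h₁, h₂, hb] using hdis
    · simpa [h₁, h₂] using hdis
  · have hsub : ∀ w, B w ⊆ if a ∈ B w then insert b (B w) else B w := by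
      intro w
      split_ifs
      · exact Set.subset_insert _ _
      · exact subset_rfl
    obtain ⟨x, hx, y, hy, -, -, -, h | ⟨rfl, h⟩ | ⟨rfl, h⟩⟩ := ha w₁ w₂ h
    · exact ⟨x, hsub _ hx, y, hsub _ hy, h⟩
    · exact ⟨b, by simp [hx], y, hsub _ hy, h⟩
    · exact ⟨x, hsub _ hx, b, by simp [hy], h.symm⟩

end Minors

section EdgeBound

variable {G : SimpleGraph V}

lemma hasMinor_K5_of_dense_neighbors [DecidableEq V] {v : V} {N : Finset V}
    (hN : ∀ w ∈ N, G.Adj v w) (hcard : N.card = 4 ∨ N.card = 5)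
    (hdeg : ∀ w ∈ N, ∃ T ⊆ N, 3 ≤ T.card ∧ ∀ x ∈ T, G.Adj w x) :
    HasMinor G (completeGraph (Fin 5)) := by
  have nonadj : ∀ w ∈ N, ∀ M ⊆ N, w ∉ M → (∀ x ∈ M, ¬ G.Adj w x) → M.card + 4 ≤ N.card := by
    intro w hw M hM hwM hna
    obtain ⟨T, hT, hT3, hTa⟩ := hdeg w hw
    have h₁ : Disjoint T (insert w M) := by
      rw [Finset.disjoint_left]
      intro x hx hx'
      rcases Finset.mem_insert.1 hx' with rfl | hx'
      · exact G.irrefl (hTa _ hx)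
      · exact hna x hx' (hTa x hx)
    have h₂ := Finset.card_le_card
      (Finset.union_subset hT (Finset.insert_subset hw hM))
    rw [Finset.card_union_of_disjoint h₁, Finset.card_insert_of_notMem hwM] at h₂
    omega
  have clique : ∀ a b c d : V, a ∈ N → b ∈ N → c ∈ N → d ∈ N → G.Adj a b → G.Adj a c →
      G.Adj a d → G.Adj b c → G.Adj b d → G.Adj c d → HasMinor G (completeGraph (Fin 5)) := by
    intro a b c d ha hb hc hd hab hac had hbc hbd hcd
    refine hasMinor_K5 ![v, a, b, c] {d} (connected_induce_singleton G d) ?_ ?_ ?_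
    · have := hN a ha; have := hN b hb; have := hN c hc
      intro i j hij
      fin_cases i <;> fin_cases j <;> simp at hij ⊢ <;>
          first | assumption | (rw [G.adj_comm]; assumption)
    · have := (hN d hd).ne; have := had.ne; have := hbd.ne; have := hcd.ne
      intro i
      fin_cases i <;> simp_all
    · have := hN d hd
      intro i
      fin_cases i <;> simp_all
  rcases hcard with h4 | h5
  · have adj : ∀ w ∈ N, ∀ x ∈ N, w ≠ x → G.Adj w x := by
      intro w hw x hx hne
      by_contra h
      have := nonadj w hw {x} (by simpa using hx) (by simpa using hne) (by simpa using h)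
      simp [h4] at this
    obtain ⟨a, b, c, d, hab, hac, had, hbc, hbd, hcd, rfl⟩ := Finset.card_eq_four.1 h4
    exact clique a b c d (by simp) (by simp) (by simp) (by simp) (adj a (by simp) b (by simp) hab)
      (adj a (by simp) c (by simp) hac) (adj a (by simp) d (by simp) had)
      (adj b (by simp) c (by simp) hbc) (adj b (by simp) d (by simp) hbd)
      (adj c (by simp) d (by simp) hcd)
  · have adj : ∀ w ∈ N, ∀ x ∈ N, ∀ y ∈ N, w ≠ x → w ≠ y → x ≠ y → ¬ G.Adj w x → G.Adj w y := by
      intro w hw x hx y hy hwx hwy hxy h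
      by_contra h'
      have := nonadj w hw {x, y} (by simp [Finset.insert_subset_iff, hx, hy])
        (by simp [hwx, hwy]) (by simp [h, h'])
      rw [Finset.card_pair hxy] at this
      omega
    by_cases hall : ∀ w ∈ N, ∀ x ∈ N, w ≠ x → G.Adj w x
    · obtain ⟨M, hM, hM4⟩ := Finset.exists_subset_card_eq (show 4 ≤ N.card by omega)
      obtain ⟨a, b, c, d, hab, hac, had, hbc, hbd, hcd, rfl⟩ := Finset.card_eq_four.1 hM4
      simp only [Finset.insert_subset_iff, Finset.singleton_subset_iff] at hM
      obtain ⟨ha, hb, hc, hd⟩ := hM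
      exact clique a b c d ha hb hc hd (hall _ ha _ hb hab) (hall _ ha _ hc hac)
        (hall _ ha _ hd had) (hall _ hb _ hc hbc) (hall _ hb _ hd hbd) (hall _ hc _ hd hcd)
    · push Not at hall
      obtain ⟨a, ha, b, hb, hab, hnab⟩ := hall
      have hc3 : ((N.erase a).erase b).card = 3 := by
        rw [Finset.card_erase_of_mem (by simp [hb, hab.symm]), Finset.card_erase_of_mem ha]
        omega
      have main : ∀ p y z : V, p ∈ (N.erase a).erase b → y ∈ (N.erase a).erase b →
          z ∈ (N.erase a).erase b → p ≠ y → p ≠ z → G.Adj y z →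
          HasMinor G (completeGraph (Fin 5)) := by
        intro p y z hp hy hz hpy hpz hyz
        simp only [Finset.mem_erase] at hp hy hz
        have hnba : ¬ G.Adj b a := fun h => hnab h.symm
        have Aap := adj a ha b hb p hp.2.2 hab hp.2.1.symm hp.1.symm hnab
        have Aay := adj a ha b hb y hy.2.2 hab hy.2.1.symm hy.1.symm hnab
        have Aaz := adj a ha b hb z hz.2.2 hab hz.2.1.symm hz.1.symm hnab
        have Abp := adj b hb a ha p hp.2.2 hab.symm hp.1.symm hp.2.1.symm hnba
        have Aby := adj b hb a ha y hy.2.2 hab.symm hy.1.symm hy.2.1.symm hnba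
        have Abz := adj b hb a ha z hz.2.2 hab.symm hz.1.symm hz.2.1.symm hnba
        refine hasMinor_K5 ![v, b, y, z] {a, p} (induce_pair_connected_of_adj Aap) ?_ ?_ ?_
        · have := hN b hb; have := hN y hy.2.2; have := hN z hz.2.2
          intro i j hij
          fin_cases i <;> fin_cases j <;> simp at hij ⊢ <;>
          first | assumption | (rw [G.adj_comm]; assumption)
        · have := (hN a ha).ne; have := (hN p hp.2.2).ne; have := Abp.ne
          intro i
          fin_cases i <;> simp_all [eq_comm]
        · have := hN a ha
          intro i
          fin_cases i
          · exact ⟨a, by simp, hN a ha⟩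
          · exact ⟨p, by simp, Abp⟩
          · exact ⟨a, by simp, Aay.symm⟩
          · exact ⟨a, by simp, Aaz.symm⟩
      obtain ⟨c, d, e, hcd, hce, hde, hM⟩ := Finset.card_eq_three.1 hc3
      have hc : c ∈ (N.erase a).erase b := by simp [hM]
      have hd : d ∈ (N.erase a).erase b := by simp [hM]
      have he : e ∈ (N.erase a).erase b := by simp [hM]
      by_cases h : G.Adj c d
      · exact main e c d he hc hd hce.symm hde.symm h
      · have mem : ∀ x, x ∈ (N.erase a).erase b → x ∈ N := fun x hx =>
          Finset.mem_of_mem_erase (Finset.mem_of_mem_erase hx)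
        exact main d c e hd hc he hcd.symm hde
          (adj c (mem c hc) d (mem d hd) e (mem e he) hcd hce hde h)

variable [Fintype V] [DecidableEq V]

lemma card_edgeFinset_le_mergeInto [DecidableRel G.Adj] {a b : V}
    [DecidableRel (mergeInto G a b).Adj] (hab : G.Adj a b) :
    G.edgeFinset.card ≤ (mergeInto G a b).edgeFinset.card + 1 +
      (G.neighborFinset a ∩ G.neighborFinset b).card := by
  have hsub : (G.deleteIncidenceSet b).edgeFinset ∪
      ((G.neighborFinset b \ G.neighborFinset a).erase a).image (fun y => s(a, y)) ⊆
      (mergeInto G a b).edgeFinset := by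
    intro e he
    induction e with | _ x y
    rw [mem_edgeFinset, mem_edgeSet]
    rcases Finset.mem_union.1 he with he | he
    · rw [mem_edgeFinset, mem_edgeSet, deleteIncidenceSet_adj] at he
      exact ⟨he.1.ne, he.2.1, he.2.2, Or.inl he.1⟩
    · obtain ⟨z, hz, hze⟩ := Finset.mem_image.1 he
      simp only [Finset.mem_erase, Finset.mem_sdiff, mem_neighborFinset] at hz
      obtain ⟨hza, hbz, haz⟩ := hz
      have : (mergeInto G a b).Adj a z :=
        ⟨hza.symm, hab.ne, hbz.ne', Or.inr (Or.inl ⟨rfl, hbz⟩)⟩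
      rw [← mem_edgeSet, hze] at this
      exact this
  have hdisj : Disjoint (G.deleteIncidenceSet b).edgeFinset
      (((G.neighborFinset b \ G.neighborFinset a).erase a).image (fun y => s(a, y))) := by
    rw [Finset.disjoint_left]
    rintro e he he'
    obtain ⟨z, hz, rfl⟩ := Finset.mem_image.1 he'
    simp only [Finset.mem_erase, Finset.mem_sdiff, mem_neighborFinset] at hz
    rw [mem_edgeFinset, mem_edgeSet, deleteIncidenceSet_adj] at he
    exact hz.2.2 he.1
  have h := Finset.card_le_card hsub
  rw [Finset.card_union_of_disjoint hdisj, card_edgeFinset_deleteIncidenceSet,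
    Finset.card_image_of_injective _ (fun x y h => Sym2.congr_right.1 h),
    Finset.card_erase_of_mem (by simp [hab.symm]), Finset.card_sdiff,
    card_neighborFinset_eq_degree] at h
  omega

theorem hasMinor_K5_of_card_edgeFinset (n : ℕ) : ∀ (G : SimpleGraph V) [DecidableRel G.Adj]
    (S : Finset V), S.card = n → S.Nonempty → (∀ x y, G.Adj x y → x ∈ S) →
    3 * n ≤ G.edgeFinset.card + 1 → HasMinor G (completeGraph (Fin 5)) := by
  induction n with
  | zero =>
    intro G _ S hS hne
    simp [Finset.card_eq_zero.1 hS] at hne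
  | succ n ih =>
    intro G _ S hS hne hsupp hcard
    obtain ⟨E, hE, hEcard⟩ := Finset.exists_subset_card_eq
      (show 3 * n + 2 ≤ G.edgeFinset.card by omega)
    classical
    obtain ⟨K, hK⟩ : ∃ K, K = fromEdgeSet (E : Set (Sym2 V)) := ⟨_, rfl⟩
    have hKG : K ≤ G := by
      intro x y hxy
      rw [hK] at hxy
      have := hE (Finset.mem_coe.1 ((fromEdgeSet_adj _).1 hxy).1)
      simpa using this
    have hKcard : K.edgeFinset.card = 3 * n + 2 := by
      rw [← hEcard]
      congr 1
      ext e
      rw [mem_edgeFinset, hK, edgeSet_fromEdgeSet]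
      refine ⟨fun h => h.1, fun h => ⟨h, fun hd => ?_⟩⟩
      exact G.not_isDiag_of_mem_edgeSet (mem_edgeFinset.1 (hE h)) hd
    have hKsupp : ∀ x y, K.Adj x y → x ∈ S := fun x y h => hsupp x y (hKG h)
    refine HasMinor.mono hKG ?_
    have herase : ∀ v ∈ S, (S.erase v).Nonempty := by
      intro v hv
      rw [← Finset.card_pos, Finset.card_erase_of_mem hv]
      by_contra h0
      have h1 : S.card = 1 := by omega
      obtain ⟨w, rfl⟩ := Finset.card_eq_one.1 h1
      have : K.edgeFinset.Nonempty := by rw [← Finset.card_pos]; omega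
      obtain ⟨e, he⟩ := this
      induction e with | _ x y
      rw [mem_edgeFinset, mem_edgeSet] at he
      have hx := hKsupp x y he
      have hy := hKsupp y x he.symm
      rw [Finset.mem_singleton] at hx hy
      exact he.ne (hx.trans hy.symm)
    by_cases hiso : ∃ v ∈ S, K.degree v = 0
    · obtain ⟨v, hv, hdv⟩ := hiso
      refine ih K (S.erase v) (by rw [Finset.card_erase_of_mem hv]; omega) (herase v hv) ?_
        (by omega)
      intro x y hxy
      refine Finset.mem_erase.2 ⟨?_, hKsupp x y hxy⟩
      rintro rfl
      have : 0 < K.degree x := (K.degree_pos_iff_exists_adj x).2 ⟨y, hxy⟩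
      omega
    by_cases hcon : ∃ a b, K.Adj a b ∧ (K.neighborFinset a ∩ K.neighborFinset b).card ≤ 2
    · obtain ⟨a, b, hab, ht⟩ := hcon
      refine HasMinor.of_mergeInto hab
        (fun w => ⟨w + 1, by simp⟩) ?_
      have hb : b ∈ S := hKsupp b a hab.symm
      refine ih (mergeInto K a b) (S.erase b) (by rw [Finset.card_erase_of_mem hb]; omega)
        (herase b hb) ?_ ?_
      · rintro x y ⟨-, hxb, -, h | ⟨rfl, -⟩ | ⟨-, h⟩⟩
        · exact Finset.mem_erase.2 ⟨hxb, hKsupp x y h⟩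
        · exact Finset.mem_erase.2 ⟨hxb, hKsupp _ _ hab⟩
        · exact Finset.mem_erase.2 ⟨hxb, hKsupp _ _ h.symm⟩
      · have := card_edgeFinset_le_mergeInto hab
        omega
    push Not at hiso hcon
    obtain ⟨v, hv, hdv⟩ : ∃ v ∈ S, K.degree v ≤ 5 := by
      by_contra! h
      have h1 := Finset.card_nsmul_le_sum S (fun v => K.degree v) 6 h
      have h2 := Finset.sum_le_univ_sum_of_nonneg (s := S) (f := fun v => K.degree v)
        (fun _ => Nat.zero_le _)
      rw [K.sum_degrees_eq_twice_card_edges] at h2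
      simp only [smul_eq_mul] at h1
      omega
    have hcommon : ∀ w ∈ K.neighborFinset v,
        ∃ T ⊆ K.neighborFinset v, 3 ≤ T.card ∧ ∀ x ∈ T, K.Adj w x := by
      intro w hw
      refine ⟨K.neighborFinset v ∩ K.neighborFinset w, Finset.inter_subset_left,
        hcon v w (by simpa using hw), fun x hx => ?_⟩
      simpa using (Finset.mem_inter.1 hx).2
    refine hasMinor_K5_of_dense_neighbors (v := v) (N := K.neighborFinset v) (by simp) ?_ hcommon
    rw [card_neighborFinset_eq_degree]
    obtain ⟨w, hw⟩ := (K.degree_pos_iff_exists_adj v).1 (Nat.pos_of_ne_zero (hiso v hv))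
    obtain ⟨T, hT, hT3, hTa⟩ := hcommon w (by simpa using hw)
    have : (insert w T).card ≤ K.degree v := by
      rw [← card_neighborFinset_eq_degree]
      exact Finset.card_le_card (Finset.insert_subset (by simpa using hw) hT)
    rw [Finset.card_insert_of_notMem (fun h => K.irrefl (hTa w h))] at this
    omega

lemma exists_degree_le_five [DecidableRel G.Adj] (hG : IsPlanar G) (S : Finset V)
    (hS : S.Nonempty) (hsupp : ∀ x y, G.Adj x y → x ∈ S) : ∃ v ∈ S, G.degree v ≤ 5 := by
  by_contra! h
  refine hG.1 (hasMinor_K5_of_card_edgeFinset S.card G S rfl hS hsupp ?_)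
  have h1 := Finset.card_nsmul_le_sum S (fun v => G.degree v) 6 h
  have h2 := Finset.sum_le_univ_sum_of_nonneg (s := S) (f := fun v => G.degree v)
    (fun _ => Nat.zero_le _)
  rw [G.sum_degrees_eq_twice_card_edges] at h2
  simp only [smul_eq_mul] at h1
  omega

end EdgeBound

section Bipartite

variable {G H : SimpleGraph V} {X W : Set V} {u v : V}

lemma hasMinor_K33_of_isCycle (hXW : Disjoint X W) (hu : ∀ x ∈ X, G.Adj u x)
    (hv : ∀ w ∈ W, G.Adj v w) (huv : G.Adj u v) (huW : u ∉ W) (hvX : v ∉ X) (hle : H ≤ G)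
    (hH : ∀ x y, H.Adj x y → (x ∈ X ∧ y ∈ W) ∨ (x ∈ W ∧ y ∈ X)) {x : V} (hx : x ∈ X)
    {c : H.Walk x x} (hc : c.IsCycle) :
    HasMinor G (completeBipartiteGraph (Fin 3) (Fin 3)) := by
  have hstep : ∀ {a b}, H.Adj a b → a ∈ X → b ∈ W := fun {a b} h ha =>
    (hH a b h).elim And.right fun h' => absurd h'.1 (Set.disjoint_left.1 hXW ha)
  have hstep' : ∀ {a b}, H.Adj a b → a ∈ W → b ∈ X := fun {a b} h ha =>
    (hH a b h).elim (fun h' => absurd ha (Set.disjoint_left.1 hXW h'.1)) And.right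
  have hsupp : ∀ {a b} (p : H.Walk a b), a ∈ X ∪ W → ∀ z ∈ p.support, z ∈ X ∪ W := by
    intro a b p
    induction p with
    | nil => intro ha z hz; simp only [Walk.support_nil, List.mem_singleton] at hz; rwa [hz]
    | cons h p ih =>
      intro ha z hz
      rcases List.mem_cons.1 hz with rfl | hz
      · exact ha
      · exact ih (ha.elim (fun h' => Or.inr (hstep h h')) fun h' => Or.inl (hstep' h h')) z hz
  have hnod := hc.support_nodup
  cases c with
  | nil => exact absurd rfl hc.ne_nil
  | @cons _ y₁ _ h₁ c =>
  have hy₁ := hstep h₁ hx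
  cases c with
  | nil => exact absurd rfl h₁.ne
  | @cons _ x₂ _ h₂ c =>
  have hx₂ := hstep' h₂ hy₁
  cases c with
  | nil => exact absurd hc.three_le_length (by simp)
  | @cons _ y₂ _ h₃ p =>
  have hy₂ := hstep h₃ hx₂
  simp only [Walk.support_cons, List.tail_cons, List.nodup_cons, List.mem_cons, not_or] at hnod
  obtain ⟨⟨hyx, hy₁p⟩, hx₂p, hp⟩ := hnod
  have hr₁ : ∀ z, z ∈ p.reverse.support → z ∈ p.support := by simp
  have hr₂ : p.reverse.support.Nodup := by simpa using hp
  generalize p.reverse = r at hr₁ hr₂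
  cases r with
  | nil => exact absurd hy₂ (Set.disjoint_left.1 hXW hx)
  | @cons _ y₃ _ h₄ q =>
  have hy₃ := hstep h₄ hx
  simp only [Walk.support_cons, List.nodup_cons, List.mem_cons] at hr₁ hr₂
  have hconn : (G.induce {z | z ∈ q.support}).Connected :=
    q.connected_induce_support.mono fun _ _ h => hle h
  have hq := hsupp q (Or.inr hy₃)
  have huX : u ∉ X := fun h => G.irrefl (hu u h)
  have hvW : v ∉ W := fun h => G.irrefl (hv v h)
  have hxx₂ : x ≠ x₂ := fun h => hx₂p (h ▸ p.end_mem_support)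
  have hxv : x ≠ v := fun h => hvX (h ▸ hx)
  have hx₂v : x₂ ≠ v := fun h => hvX (h ▸ hx₂)
  have hyu : y₁ ≠ u := fun h => huW (h ▸ hy₁)
  refine hasMinor_K33 ![x, x₂, v] ![y₁, u] {z | z ∈ q.support} hconn ?_ ?_ ?_ ?_ ?_ ?_
  · intro i j hij
    fin_cases i <;> fin_cases j <;> simp_all
  · intro i j hij
    fin_cases i <;> fin_cases j <;> simp_all
  · intro i
    fin_cases i
    · exact hr₂.1
    · exact fun h => hx₂p (hr₁ _ (Or.inr h))
    · exact fun h => (hq v h).elim hvX hvW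
  · intro i
    fin_cases i
    · exact fun h => hy₁p (hr₁ _ (Or.inr h))
    · exact fun h => (hq u h).elim huX huW
  · intro i j
    fin_cases i <;> fin_cases j
    exacts [hle h₁, (hu x hx).symm, (hle h₂).symm, (hu x₂ hx₂).symm, hv y₁ hy₁, huv.symm]
  · intro i
    fin_cases i
    exacts [⟨y₃, q.start_mem_support, hle h₄⟩, ⟨y₂, q.end_mem_support, hle h₃⟩,
      ⟨y₂, q.end_mem_support, hv y₂ hy₂⟩]

lemma isAcyclic_of_isPlanar (hG : IsPlanar G) (hXW : Disjoint X W) (hu : ∀ x ∈ X, G.Adj u x)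
    (hv : ∀ w ∈ W, G.Adj v w) (huv : G.Adj u v) (huW : u ∉ W) (hvX : v ∉ X) (hle : H ≤ G)
    (hH : ∀ x y, H.Adj x y → (x ∈ X ∧ y ∈ W) ∨ (x ∈ W ∧ y ∈ X)) : H.IsAcyclic := by
  intro x c hc
  refine hG.2 ?_
  have hx : x ∈ X ∨ x ∈ W := by
    cases c with
    | nil => exact absurd rfl hc.ne_nil
    | cons h _ => exact (hH _ _ h).imp And.left And.left
  rcases hx with hx | hx
  · exact hasMinor_K33_of_isCycle hXW hu hv huv huW hvX hle hH hx hc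
  · exact hasMinor_K33_of_isCycle hXW.symm hv hu huv.symm hvX huW hle
      (fun a b h => (hH a b h).symm) hx hc

lemma SimpleGraph.IsAcyclic.ncard_edgeSet_lt [Finite V] [Nonempty V] (hH : H.IsAcyclic) :
    H.edgeSet.ncard < Nat.card V := by
  obtain ⟨T, hHT, -, hT⟩ :=
    (connected_top (V := V)).exists_isTree_le_of_le_of_isAcyclic le_top hH
  have hle := Set.ncard_le_ncard (edgeSet_mono hHT) (Set.toFinite _)
  have hcard : T.edgeSet.ncard + 1 = Nat.card V := (isTree_iff_connected_and_card.1 hT).2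
  omega

lemma SimpleGraph.IsAcyclic.card_edgeFinset_lt [Fintype V] [DecidableEq V] [DecidableRel H.Adj]
    (hH : H.IsAcyclic) {s : Set V} (hs : s.Nonempty) (hsupp : H.support ⊆ s) :
    H.edgeFinset.card < s.ncard := by
  classical
  have : Nonempty s := hs.to_subtype
  have hlt := (hH.induce s).ncard_edgeSet_lt
  rwa [← coe_edgeFinset, Set.ncard_coe_finset,
    card_edgeFinset_induce_of_support_subset hsupp] at hlt

end Bipartite

section Opposite

variable [DecidableEq V] {G : SimpleGraph V} [DecidableRel G.Adj] {u v : V}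

/-- The edges of `G` joining a vertex of `X` to a vertex of `Y`. -/
def edgesBetween (G : SimpleGraph V) [DecidableRel G.Adj] (X Y : Finset V) : Finset (Sym2 V) :=
  ((X ×ˢ Y).filter fun p => G.Adj p.1 p.2).image fun p => s(p.1, p.2)

lemma mk_mem_edgesBetween {X Y : Finset V} {x y : V} (hx : x ∈ X) (hy : y ∈ Y) (h : G.Adj x y) :
    s(x, y) ∈ edgesBetween G X Y :=
  Finset.mem_image.2 ⟨(x, y), by simp [hx, hy, h], rfl⟩

lemma exists_of_mem_edgesBetween {X Y : Finset V} {e : Sym2 V} (he : e ∈ edgesBetween G X Y) :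
    ∃ x ∈ X, ∃ y ∈ Y, G.Adj x y ∧ e = s(x, y) := by
  obtain ⟨⟨x, y⟩, h, rfl⟩ := Finset.mem_image.1 he
  simp only [Finset.mem_filter, Finset.mem_product] at h
  exact ⟨x, h.1.1, y, h.1.2, h.2, rfl⟩

lemma adj_of_mk_mem_edgesBetween {X Y : Finset V} {x y : V} (h : s(x, y) ∈ edgesBetween G X Y) :
    G.Adj x y := by
  obtain ⟨a, -, b, -, hab, he⟩ := exists_of_mem_edgesBetween h
  rwa [← mem_edgeSet, he]

lemma card_edgesBetween_lt [Fintype V] (hG : IsPlanar G) {X W : Finset V} (hXW : Disjoint X W)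
    (hX : X.Nonempty) (hu : ∀ x ∈ X, G.Adj u x) (hv : ∀ w ∈ W, G.Adj v w) (huv : G.Adj u v)
    (huW : u ∉ W) (hvX : v ∉ X) : (edgesBetween G X W).card < X.card + W.card := by
  classical
  obtain ⟨H, hadj⟩ : ∃ H : SimpleGraph V, ∀ x y, H.Adj x y ↔ s(x, y) ∈ edgesBetween G X W ∧ x ≠ y :=
    ⟨fromEdgeSet (edgesBetween G X W : Set (Sym2 V)), fun x y => by simp⟩
  have hle : H ≤ G := fun x y h => adj_of_mk_mem_edgesBetween ((hadj x y).1 h).1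
  have hH : ∀ x y, H.Adj x y → (x ∈ (X : Set V) ∧ y ∈ (W : Set V)) ∨
      (x ∈ (W : Set V) ∧ y ∈ (X : Set V)) := by
    intro x y h
    obtain ⟨a, ha, b, hb, -, he⟩ :=
      exists_of_mem_edgesBetween ((hadj x y).1 h).1
    rcases Sym2.eq_iff.1 he with ⟨rfl, rfl⟩ | ⟨rfl, rfl⟩
    · exact Or.inl ⟨ha, hb⟩
    · exact Or.inr ⟨hb, ha⟩
  have hac := isAcyclic_of_isPlanar hG (Finset.disjoint_coe.2 hXW) hu hv huv huW hvX hle hH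
  have hlt := hac.card_edgeFinset_lt (s := (X ∪ W : Finset V))
    (Finset.coe_nonempty.2 (hX.mono Finset.subset_union_left))
    fun x ⟨y, h⟩ => Finset.mem_coe.2 (Finset.mem_union.2 ((hH x y h).imp And.left And.left))
  rw [Set.ncard_coe_finset, Finset.card_union_of_disjoint hXW] at hlt
  refine lt_of_le_of_lt (Finset.card_le_card fun e he => ?_) hlt
  obtain ⟨x, hx, y, hy, hxy, rfl⟩ := exists_of_mem_edgesBetween he
  exact mem_edgeFinset.2 ((hadj x y).2 ⟨he, hxy.ne⟩)

lemma edgesBetween_subset_offDiag {X Z : Finset V} (hZ : Z ⊆ X) :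
    edgesBetween G X Z ⊆ X.offDiag.image Sym2.mk.uncurry := by
  intro e he
  obtain ⟨x, hx, y, hy, hxy, rfl⟩ := exists_of_mem_edgesBetween he
  exact Finset.mem_image.2 ⟨(x, y), by simp [hx, hZ hy, hxy.ne], rfl⟩

lemma card_edgesBetween_subset_le (hG : IsPlanar G) {X Z : Finset V} (hZ : Z ⊆ X)
    (hX : X.card ≤ 4) (hu : ∀ x ∈ X, G.Adj u x) (hv : ∀ z ∈ Z, G.Adj v z) (huv : G.Adj u v)
    (hvX : v ∉ X) : (edgesBetween G X Z).card ≤ Z.card + 2 := by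
  have hsub := edgesBetween_subset_offDiag (G := G) hZ
  have hoff : (X.offDiag.image Sym2.mk.uncurry).card = X.card.choose 2 := Sym2.card_image_offDiag X
  have hle := Finset.card_le_card hsub
  have hZX := Finset.card_le_card hZ
  have full : Z.card = 3 → X.card = 4 → (edgesBetween G X Z).card ≠ 6 := by
    intro hZ3 hX4 hcard
    have heq := Finset.eq_of_subset_of_card_le hsub (by rw [hoff, hX4, hcard]; decide)
    have adj : ∀ x ∈ X, ∀ y ∈ X, x ≠ y → G.Adj x y := by
      intro x hx y hy hxy
      refine adj_of_mk_mem_edgesBetween (X := X) (Y := Z) ?_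
      rw [heq]
      exact Finset.mem_image.2 ⟨(x, y), by simp [hx, hy, hxy], rfl⟩
    refine hG.1 (hasMinor_K5 (fun i => (X.equivFinOfCardEq hX4).symm i) {u}
      (connected_induce_singleton G u) (fun i j hij => ?_) (fun i h => ?_) fun i => ?_)
    · exact adj _ (Subtype.prop _) _ (Subtype.prop _) (by simpa [Subtype.ext_iff] using hij)
    · exact (hu _ (Subtype.prop _)).ne (Set.mem_singleton_iff.1 h).symm
    · exact ⟨u, rfl, (hu _ (Subtype.prop _)).symm⟩
  have two : Z.card = 2 → X.card = 4 → (edgesBetween G X Z).card ≤ 4 := by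
    intro hZ2 hX4
    obtain ⟨z₁, z₂, hz, rfl⟩ := Finset.card_eq_two.1 hZ2
    have hsd : (X \ {z₁, z₂}).card = 2 := by
      rw [Finset.card_sdiff_of_subset hZ]; omega
    obtain ⟨x₁, x₂, hx, hXe⟩ := Finset.card_eq_two.1 hsd
    have hx₁ : x₁ ∈ X \ {z₁, z₂} := by simp [hXe]
    have hx₂ : x₂ ∈ X \ {z₁, z₂} := by simp [hXe]
    simp only [Finset.mem_sdiff, Finset.mem_insert, Finset.mem_singleton, not_or] at hx₁ hx₂
    have hz₁ : z₁ ∈ X := hZ (by simp)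
    have hz₂ : z₂ ∈ X := hZ (by simp)
    have hmem : s(x₁, x₂) ∈ X.offDiag.image Sym2.mk.uncurry :=
      Finset.mem_image.2 ⟨(x₁, x₂), by simp [hx₁, hx₂, hx], rfl⟩
    have hsub' : edgesBetween G X {z₁, z₂} ⊆
        (X.offDiag.image Sym2.mk.uncurry).erase s(x₁, x₂) := by
      intro e he
      refine Finset.mem_erase.2 ⟨?_, hsub he⟩
      rintro rfl
      obtain ⟨a, -, b, hb, -, he⟩ := exists_of_mem_edgesBetween he
      simp only [Finset.mem_insert, Finset.mem_singleton] at hb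
      rcases Sym2.eq_iff.1 he with ⟨rfl, rfl⟩ | ⟨rfl, rfl⟩ <;> tauto
    by_contra! hcard
    have heq := Finset.eq_of_subset_of_card_le hsub' (by
      rw [Finset.card_erase_of_mem hmem, hoff, hX4]
      exact hcard)
    have adj : ∀ x ∈ X, ∀ z ∈ X, x ≠ z → s(z, x) ≠ s(x₁, x₂) → G.Adj z x := by
      intro x hx z hz hxz hne
      refine adj_of_mk_mem_edgesBetween (X := X) (Y := {z₁, z₂}) ?_
      rw [heq]
      exact Finset.mem_erase.2
        ⟨hne, Finset.mem_image.2 ⟨(z, x), by simp [hx, hz, hxz.symm], rfl⟩⟩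
    have hne : ∀ z x, z ≠ x₁ → z ≠ x₂ → s(z, x) ≠ s(x₁, x₂) := fun z x h₁ h₂ h =>
      (Sym2.eq_iff.1 h).elim (fun h => h₁ h.1) fun h => h₂ h.1
    have hvx : ∀ x ∈ X, x ≠ v := fun x hx h => hvX (h ▸ hx)
    have hux : ∀ x ∈ X, u ≠ x := fun x hx => (hu x hx).ne
    refine hG.2 (hasMinor_K33 ![z₁, z₂, u] ![x₁, x₂] {v} (connected_induce_singleton G v)
      ?_ ?_ ?_ ?_ ?_ ?_)
    · have := hux z₁ hz₁
      have := hux z₂ hz₂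
      intro i j hij
      fin_cases i <;> fin_cases j <;> simp_all
    · intro i j hij
      fin_cases i <;> fin_cases j <;> simp_all
    · intro i
      fin_cases i
      exacts [hvx z₁ hz₁, hvx z₂ hz₂, huv.ne]
    · intro i
      fin_cases i
      exacts [hvx x₁ hx₁.1, hvx x₂ hx₂.1]
    · intro i j
      fin_cases i <;> fin_cases j
      · exact adj x₁ hx₁.1 z₁ hz₁ hx₁.2.1 (hne _ _ (Ne.symm hx₁.2.1) (Ne.symm hx₂.2.1))
      · exact adj x₂ hx₂.1 z₁ hz₁ hx₂.2.1 (hne _ _ (Ne.symm hx₁.2.1) (Ne.symm hx₂.2.1))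
      · exact adj x₁ hx₁.1 z₂ hz₂ hx₁.2.2 (hne _ _ (Ne.symm hx₁.2.2) (Ne.symm hx₂.2.2))
      · exact adj x₂ hx₂.1 z₂ hz₂ hx₂.2.2 (hne _ _ (Ne.symm hx₁.2.2) (Ne.symm hx₂.2.2))
      · exact hu x₁ hx₁.1
      · exact hu x₂ hx₂.1
    · intro i
      fin_cases i
      exacts [⟨v, rfl, (hv z₁ (by simp)).symm⟩, ⟨v, rfl, (hv z₂ (by simp)).symm⟩, ⟨v, rfl, huv⟩]
  have one : Z.card = 1 → (edgesBetween G X Z).card + 1 ≤ X.card := by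
    intro hZ1
    obtain ⟨z, rfl⟩ := Finset.card_eq_one.1 hZ1
    have hz : z ∈ X := hZ (by simp)
    have : edgesBetween G X {z} ⊆ (X.erase z).image fun x => s(x, z) := by
      intro e he
      obtain ⟨x, hx, y, hy, hxy, rfl⟩ := exists_of_mem_edgesBetween he
      obtain rfl := Finset.mem_singleton.1 hy
      exact Finset.mem_image.2 ⟨x, Finset.mem_erase.2 ⟨hxy.ne, hx⟩, rfl⟩
    have := (Finset.card_le_card this).trans Finset.card_image_le
    rw [Finset.card_erase_of_mem hz] at this
    have := Finset.card_pos.2 ⟨z, hz⟩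
    omega
  have zero : Z.card = 0 → (edgesBetween G X Z).card = 0 := by
    intro hZ0
    simp [Finset.card_eq_zero.1 hZ0, edgesBetween]
  rw [hoff] at hle
  generalize hm : (edgesBetween G X Z).card = m at *
  generalize hk : X.card = k at *
  interval_cases k <;> simp [Nat.choose] at hle <;> omega

/-- If `uv` is an edge of a planar graph, there are few edges between sets of neighbors
of `u` and of `v`. -/
lemma card_edgesBetween_le [Fintype V] (hG : IsPlanar G) {X Y : Finset V} (hX : X.card ≤ 4)
    (hu : ∀ x ∈ X, G.Adj u x) (hv : ∀ y ∈ Y, G.Adj v y) (huv : G.Adj u v) (huY : u ∉ Y)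
    (hvX : v ∉ X) : (edgesBetween G X Y).card ≤ X.card + Y.card + 1 := by
  rcases X.eq_empty_or_nonempty with rfl | hXne
  · simp [edgesBetween]
  have hsub : edgesBetween G X Y ⊆ edgesBetween G X (Y \ X) ∪ edgesBetween G X (X ∩ Y) := by
    intro e he
    obtain ⟨x, hx, y, hy, hxy, rfl⟩ := exists_of_mem_edgesBetween he
    by_cases h : y ∈ X
    · exact Finset.mem_union_right _ (mk_mem_edgesBetween hx (by simp [h, hy]) hxy)
    · exact Finset.mem_union_left _ (mk_mem_edgesBetween hx (by simp [h, hy]) hxy)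
  have h₁ := card_edgesBetween_lt hG (X := X) (W := Y \ X) Finset.disjoint_sdiff hXne hu
    (fun w hw => hv w (Finset.mem_sdiff.1 hw).1) huv (fun h => huY (Finset.mem_sdiff.1 h).1) hvX
  have h₂ := card_edgesBetween_subset_le hG (X := X) (Z := X ∩ Y) Finset.inter_subset_left hX hu
    (fun z hz => hv z (Finset.mem_inter.1 hz).2) huv hvX
  have h₃ := (Finset.card_le_card hsub).trans (Finset.card_union_le _ _)
  have h₄ := Finset.card_sdiff_add_card_inter Y X
  rw [Finset.inter_comm] at h₄
  omega

end Opposite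

section Coloring

lemma OppC4.symm {G : SimpleGraph V} {e f : Sym2 V} (h : OppC4 G e f) : OppC4 G f e := by
  obtain ⟨a, b, c, d, ⟨hab, hac, had, hbc, hbd, hcd, h₁, h₂, h₃, h₄⟩, rfl, rfl⟩ := h
  exact ⟨c, d, a, b, ⟨hcd, hac.symm, hbc.symm, had.symm, hbd.symm, hab, h₃, h₄, h₁, h₂⟩, rfl, rfl⟩

/-- Two distinct edges of `G` are adjacent if they must receive distinct colors in a
B-coloring. -/
def conflictGraph (G : SimpleGraph V) : SimpleGraph (Sym2 V) where
  Adj e f := e ≠ f ∧ e ∈ G.edgeSet ∧ f ∈ G.edgeSet ∧ ((∃ v, v ∈ e ∧ v ∈ f) ∨ OppC4 G e f)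
  symm := ⟨fun _ _ ⟨hne, he, hf, h⟩ =>
    ⟨hne.symm, hf, he, h.imp (fun ⟨v, hv⟩ => ⟨v, hv.symm⟩) OppC4.symm⟩⟩
  loopless := ⟨fun _ h => h.1 rfl⟩

lemma isBColoring_of_conflictGraph {G : SimpleGraph V} {α : Type*} {C : Sym2 V → α}
    (hC : ∀ e f, (conflictGraph G).Adj e f → C e ≠ C f) : IsBColoring G C := by
  have share : ∀ a b c, G.Adj a b → G.Adj a c → b ≠ c → C s(a, b) ≠ C s(a, c) :=
    fun a b c hab hac hbc => hC _ _ ⟨fun h => hbc (Sym2.congr_right.1 h), hab, hac,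
      Or.inl ⟨a, Sym2.mem_mk_left _ _, Sym2.mem_mk_left _ _⟩⟩
  have opp : ∀ a b c d, IsC4 G a b c d → C s(a, b) ≠ C s(c, d) := by
    intro a b c d h
    refine hC _ _ ⟨fun he => ?_, h.2.2.2.2.2.2.1, h.2.2.2.2.2.2.2.2.1,
      Or.inr ⟨a, b, c, d, h, rfl, rfl⟩⟩
    exact (Sym2.eq_iff.1 he).elim (fun h' => h.2.1 h'.1) fun h' => h.2.2.1 h'.1
  refine ⟨share, fun a b c d h => ?_⟩
  have h' := h
  obtain ⟨hab, hac, had, hbc, hbd, hcd, h₁, h₂, h₃, h₄⟩ := h'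
  refine ⟨?_, opp a b c d h, ?_, ?_, opp b c d a
    ⟨hbc, hbd, hab.symm, hcd, hac.symm, had.symm, h₂, h₃, h₄, h₁⟩, ?_⟩
  · rw [Sym2.eq_swap]; exact share b a c h₁.symm h₂ hac
  · rw [Sym2.eq_swap (a := d)]; exact share a b d h₁ h₄.symm hbd
  · rw [Sym2.eq_swap]; exact share c b d h₂.symm h₃ hbd
  · rw [Sym2.eq_swap]; exact share d c a h₃.symm h₄ hac.symm

lemma SimpleGraph.exists_extend_coloring {α : Type*} (L : SimpleGraph α) {k : ℕ} {A : Set α}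
    {C : α → Fin k} (hC : ∀ e ∈ A, ∀ f ∈ A, L.Adj e f → C e ≠ C f) (B : Finset α)
    (hB : ∀ e ∈ B, ∃ N : Finset α, N.card < k ∧ ∀ f, L.Adj e f → f ∈ N) :
    ∃ C' : α → Fin k, ∀ e ∈ A ∪ B, ∀ f ∈ A ∪ B, L.Adj e f → C' e ≠ C' f := by
  classical
  induction B using Finset.induction_on with
  | empty => exact ⟨C, by simpa using hC⟩
  | insert e B _ ih =>
    obtain ⟨C', hC'⟩ := ih fun f hf => hB f (Finset.mem_insert_of_mem hf)
    obtain ⟨N, hN, hLN⟩ := hB e (Finset.mem_insert_self e B)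
    obtain ⟨i, hi⟩ : ∃ i, i ∉ N.image C' := by
      by_contra! h
      have := Finset.card_le_card (fun i _ => h i : Finset.univ ⊆ N.image C')
      have := Finset.card_image_le (s := N) (f := C')
      simp only [Finset.card_univ, Fintype.card_fin] at *
      omega
    have hne : ∀ f, L.Adj e f → i ≠ C' f := fun f hf h =>
      hi (Finset.mem_image.2 ⟨f, hLN f hf, h.symm⟩)
    refine ⟨Function.update C' e i, fun f hf g hg hfg => ?_⟩
    have mem : ∀ f, f ∈ A ∪ (insert e B : Finset α) → f ≠ e → f ∈ A ∪ (B : Set α) := by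
      intro f hf hfe
      simpa [hfe] using hf
    by_cases hfe : f = e
    · subst hfe
      simpa [hfg.ne'] using hne g hfg
    · by_cases hge : g = e
      · subst hge
        simpa [hfe] using (hne f hfg.symm).symm
      · simpa [hfe, hge] using hC' f (mem f hf hfe) g (mem g hg hge) hfg

lemma conflictGraph_deleteIncidenceSet_adj {G : SimpleGraph V} {u : V} {e f : Sym2 V}
    (he : u ∉ e) (hf : u ∉ f) (h : (conflictGraph G).Adj e f) :
    (conflictGraph (G.deleteIncidenceSet u)).Adj e f := by
  have mem : ∀ e, u ∉ e → e ∈ G.edgeSet → e ∈ (G.deleteIncidenceSet u).edgeSet := fun e he h =>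
    edgeSet_deleteIncidenceSet G u ▸ ⟨h, fun h' => he h'.2⟩
  obtain ⟨hne, heG, hfG, h⟩ := h
  refine ⟨hne, mem e he heG, mem f hf hfG, h.imp_right ?_⟩
  rintro ⟨a, b, c, d, ⟨hab, hac, had, hbc, hbd, hcd, h₁, h₂, h₃, h₄⟩, rfl, rfl⟩
  simp only [Sym2.mem_iff, not_or] at he hf
  refine ⟨a, b, c, d, ⟨hab, hac, had, hbc, hbd, hcd, ?_, ?_, ?_, ?_⟩, rfl, rfl⟩ <;>
    rw [deleteIncidenceSet_adj] <;> tauto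

variable [Fintype V] [DecidableEq V]

lemma exists_card_lt_of_conflictGraph_adj {G : SimpleGraph V} [DecidableRel G.Adj]
    (hG : IsPlanar G) {u v : V} (huv : G.Adj u v) {Δ : ℕ} (hu : G.degree u ≤ 5)
    (hv : G.degree v ≤ Δ) :
    ∃ N : Finset (Sym2 V), N.card < 2 * Δ + 8 ∧ ∀ f, (conflictGraph G).Adj s(u, v) f → f ∈ N := by
  have huN : v ∈ G.neighborFinset u := by simpa using huv
  have hvN : u ∈ G.neighborFinset v := by simpa using huv.symm
  have cX := Finset.card_erase_add_one huN
  have cY := Finset.card_erase_add_one hvN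
  have cu := Finset.card_erase_add_one
    ((G.mem_incidenceFinset u _).2 (G.mem_incidenceSet u v |>.2 huv))
  have cv := Finset.card_erase_add_one
    ((G.mem_incidenceFinset v _).2 (G.mem_incidenceSet v u |>.2 huv.symm))
  rw [Sym2.eq_swap] at cv
  rw [card_neighborFinset_eq_degree] at cX cY
  rw [card_incidenceFinset_eq_degree] at cu cv
  refine ⟨(G.incidenceFinset u).erase s(u, v) ∪ (G.incidenceFinset v).erase s(u, v) ∪
    edgesBetween G ((G.neighborFinset u).erase v) ((G.neighborFinset v).erase u), ?_, ?_⟩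
  · have h₁ := card_edgesBetween_le hG (X := (G.neighborFinset u).erase v)
      (Y := (G.neighborFinset v).erase u) (by omega) (fun x hx => by simp_all)
      (fun y hy => by simp_all) huv (by simp) (by simp)
    have h₂ := Finset.card_union_le ((G.incidenceFinset u).erase s(u, v) ∪
      (G.incidenceFinset v).erase s(u, v))
      (edgesBetween G ((G.neighborFinset u).erase v) ((G.neighborFinset v).erase u))
    have h₃ := Finset.card_union_le ((G.incidenceFinset u).erase s(u, v))
      ((G.incidenceFinset v).erase s(u, v))
    omega
  · rintro f ⟨hne, -, hf, ⟨w, hw, hwf⟩ | ⟨a, b, c, d, hC, he, rfl⟩⟩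
    · refine Finset.mem_union_left _ (Finset.mem_union.2 ?_)
      rcases Sym2.mem_iff.1 hw with rfl | rfl
      · exact Or.inl (Finset.mem_erase.2 ⟨hne.symm, (G.mem_incidenceFinset _ _).2 ⟨hf, hwf⟩⟩)
      · exact Or.inr (Finset.mem_erase.2 ⟨hne.symm, (G.mem_incidenceFinset _ _).2 ⟨hf, hwf⟩⟩)
    · refine Finset.mem_union_right _ ?_
      obtain ⟨-, hac, had, hbc, hbd, -, -, h₂, h₃, h₄⟩ := hC
      rcases Sym2.eq_iff.1 he with ⟨rfl, rfl⟩ | ⟨rfl, rfl⟩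
      · rw [Sym2.eq_swap]
        exact mk_mem_edgesBetween (by simp [hbd.symm, h₄.symm]) (by simp [hac.symm, h₂]) h₃.symm
      · exact mk_mem_edgesBetween (by simp [hac.symm, h₂]) (by simp [hbd.symm, h₄.symm]) h₃

lemma exists_conflictGraph_coloring {Δ : ℕ} (S : Finset V) :
    ∀ (G : SimpleGraph V) [DecidableRel G.Adj], IsPlanar G → (∀ v, G.degree v ≤ Δ) →
      (∀ x y, G.Adj x y → x ∈ S) →
      ∃ C : Sym2 V → Fin (2 * Δ + 8), ∀ e f, (conflictGraph G).Adj e f → C e ≠ C f := by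
  classical
  induction S using Finset.strongInduction with
  | H S ih =>
    intro G _ hG hΔ hsupp
    rcases S.eq_empty_or_nonempty with rfl | hS
    · refine ⟨fun _ => ⟨0, by omega⟩, fun e f h => ?_⟩
      obtain ⟨-, he, -⟩ := h
      induction e with
      | h x y => exact absurd (hsupp x y he) (Finset.notMem_empty x)
    obtain ⟨u, huS, hu⟩ := exists_degree_le_five hG S hS hsupp
    have hle := G.deleteIncidenceSet_le u
    obtain ⟨C, hC⟩ := ih (S.erase u) (Finset.erase_ssubset huS) (G.deleteIncidenceSet u)
      (hG.anti hle) (fun v => (degree_le_of_le hle).trans (hΔ v)) fun x y h => by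
        rw [deleteIncidenceSet_adj] at h
        exact Finset.mem_erase.2 ⟨h.2.1, hsupp x y h.1⟩
    obtain ⟨C', hC'⟩ := (conflictGraph G).exists_extend_coloring (A := {e | u ∉ e}) (C := C)
      (fun e he f hf h => hC e f (conflictGraph_deleteIncidenceSet_adj he hf h))
      (G.incidenceFinset u) fun e he => by
        obtain ⟨v, rfl⟩ := ((G.mem_incidenceFinset u e).1 he).2
        exact exists_card_lt_of_conflictGraph_adj hG ((G.mem_incidenceFinset u _).1 he).1 hu (hΔ v)
    have mem : ∀ e ∈ G.edgeSet, e ∈ {e | u ∉ e} ∪ (G.incidenceFinset u : Set (Sym2 V)) := by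
      intro e he
      by_cases hue : u ∈ e
      · exact Or.inr (Finset.mem_coe.2 ((G.mem_incidenceFinset u e).2 ⟨he, hue⟩))
      · exact Or.inl hue
    exact ⟨C', fun e f h => hC' e (mem e h.2.1) f (mem f h.2.2.1) h⟩

end Coloring

theorem qB_planar_le {V : Type*} [Fintype V] [DecidableEq V] (G : SimpleGraph V)
    [DecidableRel G.Adj] (hG : IsPlanar G) (Δ : ℕ) (hΔ : ∀ v, G.degree v ≤ Δ) :
    qB G ≤ 2 * Δ + 8 := by
  obtain ⟨C, hC⟩ := exists_conflictGraph_coloring Finset.univ G hG hΔ fun x _ _ => Finset.mem_univ x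
  exact Nat.sInf_le ⟨C, isBColoring_of_conflictGraph hC⟩
end

section
/- Every planar graph with maximum degree at most 3 satisfies q_B(G) ≤ 6. -/
open SimpleGraph

variable {V : Type*}

namespace SubcubicBColoring

/-- Two edges of `G` that must receive different colors in every B-coloring. -/
def Conflict (G : SimpleGraph V) (e f : Sym2 V) : Prop :=
  (∃ a b c : V, G.Adj a b ∧ G.Adj a c ∧ b ≠ c ∧ e = s(a, b) ∧ f = s(a, c)) ∨ OppC4 G e f

/-- The edges in `S` can be given six colors such that conflicting ones differ. -/
def SixColorable (G : SimpleGraph V) (S : Finset (Sym2 V)) : Prop :=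
  ∃ C : Sym2 V → Fin 6, ∀ e ∈ S, ∀ f ∈ S, Conflict G e f → C e ≠ C f

/-- Every edge in `S` conflicts with at least six edges in `S`. -/
def Dense (G : SimpleGraph V) (S : Finset (Sym2 V)) : Prop :=
  ∀ e ∈ S, ∀ T : Finset (Sym2 V), T.card ≤ 5 → ∃ f ∈ S, f ∉ T ∧ Conflict G e f

/-- Any four neighbors of a vertex of `G` contain a repetition. -/
def Subcubic (G : SimpleGraph V) : Prop :=
  ∀ u x y z w : V, G.Adj u x → G.Adj u y → G.Adj u z → G.Adj u w →
    x ≠ y → x ≠ z → y ≠ z → w = x ∨ w = y ∨ w = z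

theorem Conflict.symm {G : SimpleGraph V} {e f : Sym2 V} (h : Conflict G e f) :
    Conflict G f e := by
  rcases h with ⟨a, b, c, hab, hac, hbc, he, hf⟩ | ⟨a, b, c, d, h, he, hf⟩
  · exact Or.inl ⟨a, c, b, hac, hab, hbc.symm, hf, he⟩
  · obtain ⟨h1, h2, h3, h4, h5, h6, h7, h8, h9, h10⟩ := h
    exact Or.inr ⟨c, d, a, b, ⟨h6, h2.symm, h4.symm, h3.symm, h5.symm, h1, h9, h10, h7, h8⟩, hf, he⟩

theorem Conflict.cases {G : SimpleGraph V} {u v : V} {f : Sym2 V} (h : Conflict G s(u, v) f) :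
    G.Adj u v ∧ ((∃ w, w ≠ v ∧ G.Adj u w ∧ f = s(u, w)) ∨ (∃ w, w ≠ u ∧ G.Adj v w ∧ f = s(v, w)) ∨
      ∃ p q, p ≠ v ∧ q ≠ u ∧ G.Adj u p ∧ G.Adj v q ∧ G.Adj p q ∧ f = s(p, q)) := by
  rcases h with ⟨a, b, c, hab, hac, hbc, he, hf⟩ | ⟨a, b, c, d, h, he, hf⟩
  · rcases Sym2.eq_iff.1 he with ⟨rfl, rfl⟩ | ⟨rfl, rfl⟩
    · exact ⟨hab, Or.inl ⟨c, hbc.symm, hac, hf⟩⟩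
    · exact ⟨hab.symm, Or.inr (Or.inl ⟨c, hbc.symm, hac, hf⟩)⟩
  · obtain ⟨h1, h2, h3, h4, h5, h6, h7, h8, h9, h10⟩ := h
    rcases Sym2.eq_iff.1 he with ⟨rfl, rfl⟩ | ⟨rfl, rfl⟩
    · exact ⟨h7, Or.inr (Or.inr ⟨d, c, h5.symm, h2.symm, h10.symm, h8, h9.symm,
        hf.trans Sym2.eq_swap⟩)⟩
    · exact ⟨h7.symm, Or.inr (Or.inr ⟨c, d, h2.symm, h5.symm, h8, h10.symm, h9, hf⟩)⟩

theorem subcubic_of_degree_le [Fintype V] [DecidableEq V] {G : SimpleGraph V}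
    [DecidableRel G.Adj] (h : ∀ v, G.degree v ≤ 3) : Subcubic G := by
  intro u x y z w hx hy hz hw hxy hxz hyz
  by_contra! hne
  obtain ⟨h1, h2, h3⟩ := hne
  have hsub : ({w, x, y, z} : Finset V) ⊆ G.neighborFinset u := by
    intro t ht
    simp only [Finset.mem_insert, Finset.mem_singleton] at ht
    rcases ht with rfl | rfl | rfl | rfl <;> simpa
  have hcard : ({w, x, y, z} : Finset V).card = 4 := by
    simp [*]
  have := Finset.card_le_card hsub
  rw [G.card_neighborFinset_eq_degree, hcard] at this
  exact absurd (h u) (by omega)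

theorem Subcubic.exists_pair {G : SimpleGraph V} (hG : Subcubic G) {u v : V} (huv : G.Adj u v) :
    ∃ a b, ∀ w, G.Adj u w → w ≠ v → w = a ∨ w = b := by
  by_cases h : ∃ a, G.Adj u a ∧ a ≠ v
  · obtain ⟨a, ha, hav⟩ := h
    by_cases h' : ∃ b, G.Adj u b ∧ b ≠ v ∧ b ≠ a
    · obtain ⟨b, hb, hbv, hba⟩ := h'
      refine ⟨a, b, fun w hw hwv => ?_⟩
      rcases hG u v a b w huv ha hb hw hav.symm hbv.symm hba.symm with h | h | h
      · exact absurd h hwv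
      · exact Or.inl h
      · exact Or.inr h
    · exact ⟨a, a, fun w hw hwv => by by_contra hc; exact h' ⟨w, hw, hwv, by tauto⟩⟩
  · exact ⟨v, v, fun w hw hwv => absurd ⟨w, hw, hwv⟩ h⟩

variable {G : SimpleGraph V} {S : Finset (Sym2 V)}

theorem Dense.adj (hS : Dense G S) {u v : V} (h : s(u, v) ∈ S) : G.Adj u v := by
  obtain ⟨f, -, -, hf⟩ := hS _ h ∅ (by simp)
  exact hf.cases.1

/-- The endpoints of an edge of a dense set have three neighbors. -/
theorem Dense.exists_third (hG : Subcubic G) (hS : Dense G S) {u v : V} (a : V)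
    (h : s(u, v) ∈ S) : ∃ b, G.Adj u b ∧ b ≠ v ∧ b ≠ a := by
  classical
  by_contra! hb
  have huv := hS.adj h
  obtain ⟨c, d, hcd⟩ := hG.exists_pair huv.symm
  obtain ⟨f, -, hfT, hf⟩ := hS _ h {s(u, a), s(v, c), s(v, d), s(a, c), s(a, d)} Finset.card_le_five
  apply hfT
  rcases hf.cases.2 with ⟨w, hw, hw', rfl⟩ | ⟨w, hw, hw', rfl⟩ | ⟨p, q, hp, hq, hp', hq', -, rfl⟩
  · obtain rfl := hb w hw' hw
    simp
  · rcases hcd w hw' hw with rfl | rfl <;> simp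
  · obtain rfl := hb p hp' hp
    rcases hcd q hq' hq with rfl | rfl <;> simp

/-- All neighbors of an endpoint `u` of an edge `uv` of a dense set, given one other than `v`. -/
theorem Dense.exists_neighbors (hG : Subcubic G) (hS : Dense G S) {u v a : V}
    (h : s(u, v) ∈ S) (ha : G.Adj u a) (hav : a ≠ v) :
    ∃ b, G.Adj u b ∧ b ≠ v ∧ b ≠ a ∧ ∀ w, G.Adj u w → w ≠ v → w = a ∨ w = b := by
  obtain ⟨b, hb, hbv, hba⟩ := hS.exists_third hG a h
  refine ⟨b, hb, hbv, hba, fun w hw hwv => ?_⟩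
  have := hG u v a b w (hS.adj h) ha hb hw hav.symm hbv.symm hba.symm
  tauto

/-- A conflict of `uv` outside a given set of five edges, in terms of the neighbors of the
endpoints. -/
theorem Dense.exists_conflict [DecidableEq V] (hS : Dense G S) {u v a b c d : V}
    (h : s(u, v) ∈ S)
    (hu : ∀ w, G.Adj u w → w ≠ v → w = a ∨ w = b) (hv : ∀ w, G.Adj v w → w ≠ u → w = c ∨ w = d)
    (T : Finset (Sym2 V)) (hT : T.card ≤ 5) :
    ∃ f ∈ S, f ∉ T ∧ (f = s(u, a) ∨ f = s(u, b) ∨ f = s(v, c) ∨ f = s(v, d) ∨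
      (G.Adj a c ∧ f = s(a, c)) ∨ (G.Adj a d ∧ f = s(a, d)) ∨
      (G.Adj b c ∧ f = s(b, c)) ∨ (G.Adj b d ∧ f = s(b, d))) := by
  obtain ⟨f, hfS, hfT, hf⟩ := hS _ h T hT
  refine ⟨f, hfS, hfT, ?_⟩
  rcases hf.cases.2 with ⟨w, hw, hw', rfl⟩ | ⟨w, hw, hw', rfl⟩ | ⟨p, q, hp, hq, hp', hq', hpq, rfl⟩
  · rcases hu w hw' hw with rfl | rfl <;> simp
  · rcases hv w hw' hw with rfl | rfl <;> simp
  · rcases hu p hp' hp with rfl | rfl <;> rcases hv q hq' hq with rfl | rfl <;> simp [hpq]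

/-- If a spoke `uv` of a `K₂,₃` with parts `{v, a}` and `{u, c, d}` lies in a dense set, then the
third neighbor of `u` is adjacent to `c` or `d`. -/
theorem Dense.exists_adj_of_K23 (hG : Subcubic G) (hS : Dense G S) {u v a c d : V}
    (h : s(u, v) ∈ S) (hav : a ≠ v) (huc : u ≠ c) (hud : u ≠ d) (hcd : c ≠ d)
    (hua : G.Adj u a) (hvc : G.Adj v c) (hvd : G.Adj v d) (hac : G.Adj a c) (had : G.Adj a d) :
    ∃ b, G.Adj u b ∧ b ≠ v ∧ b ≠ a ∧ (G.Adj b c ∨ G.Adj b d) := by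
  classical
  have huv := hS.adj h
  obtain ⟨b, hub, hbv, hba, hu⟩ := hS.exists_neighbors hG h hua hav
  refine ⟨b, hub, hbv, hba, ?_⟩
  by_contra! hb
  have hv : ∀ w, G.Adj v w → w ≠ u → w = c ∨ w = d := fun w hw hwu => by
    have := hG v u c d w huv.symm hvc hvd hw huc hud hcd
    tauto
  have ha : ∀ w, G.Adj a w → w ≠ u → w = c ∨ w = d := fun w hw hwu => by
    have := hG a u c d w hua.symm hac had hw huc hud hcd
    tauto
  have hubS : s(u, b) ∈ S := by
    obtain ⟨f, hfS, hfT, hf⟩ := hS.exists_conflict h hu hv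
      {s(u, a), s(v, c), s(v, d), s(a, c), s(a, d)} Finset.card_le_five
    rcases hf with rfl | rfl | rfl | rfl | ⟨h1, rfl⟩ | ⟨h1, rfl⟩ | ⟨h1, rfl⟩ | ⟨h1, rfl⟩ <;>
      first | assumption | (exfalso; apply hfT; simp; done) | tauto
  obtain ⟨x, y, hxy⟩ := hG.exists_pair hub.symm
  have hu' : ∀ w, G.Adj u w → w ≠ b → w = v ∨ w = a := fun w hw hwb => by
    by_cases hwv : w = v
    · exact Or.inl hwv
    · exact Or.inr ((hu w hw hwv).resolve_right hwb)
  obtain ⟨f, -, hfT, hf⟩ := hS _ hubS {s(u, v), s(u, a), s(b, x), s(b, y)}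
    (Finset.card_le_four.trans (by norm_num))
  rcases hf.cases.2 with ⟨w, hw, hw', rfl⟩ | ⟨w, hw, hw', rfl⟩ | ⟨p, q, hp, hq, hp', hq', hpq, rfl⟩
  · apply hfT
    rcases hu' w hw' hw with rfl | rfl <;> simp
  · apply hfT
    rcases hxy w hw' hw with rfl | rfl <;> simp
  · rcases hu' p hp' hp with rfl | rfl
    · rcases hv q hpq hq with rfl | rfl <;> tauto
    · rcases ha q hpq hq with rfl | rfl <;> tauto

theorem hasMinor_K33 {v₀ v₁ v₂ w₀ w₁ w₂ : V} (h01 : v₀ ≠ v₁) (h02 : v₀ ≠ v₂) (h12 : v₁ ≠ v₂)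
    (h01' : w₀ ≠ w₁) (h02' : w₀ ≠ w₂) (h12' : w₁ ≠ w₂)
    (h00 : G.Adj v₀ w₀) (h0 : G.Adj v₀ w₁) (h0' : G.Adj v₀ w₂)
    (h1 : G.Adj v₁ w₀) (h11 : G.Adj v₁ w₁) (h1' : G.Adj v₁ w₂)
    (h2 : G.Adj v₂ w₀) (h2' : G.Adj v₂ w₁) (h22 : G.Adj v₂ w₂) :
    HasMinor G (completeBipartiteGraph (Fin 3) (Fin 3)) := by
  have hadj : ∀ i j, G.Adj (![v₀, v₁, v₂] i) (![w₀, w₁, w₂] j) := by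
    intro i j
    fin_cases i <;> fin_cases j <;> simpa
  have hv : Function.Injective ![v₀, v₁, v₂] := by
    intro i j
    fin_cases i <;> fin_cases j <;> simp [*, Ne.symm]
  have hw : Function.Injective ![w₀, w₁, w₂] := by
    intro i j
    fin_cases i <;> fin_cases j <;> simp [*, Ne.symm]
  refine ⟨fun x => {Sum.elim ![v₀, v₁, v₂] ![w₀, w₁, w₂] x}, fun x => ?_, fun x y hxy => ?_,
    fun x y hxy => ?_⟩
  · rw [SimpleGraph.induce_singleton_eq_top]
    exact SimpleGraph.connected_top
  · rw [Set.disjoint_singleton]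
    exact fun he => hxy (hv.sumElim hw (fun i j => (hadj i j).ne) he)
  · refine ⟨_, rfl, _, rfl, ?_⟩
    rcases x with i | i <;> rcases y with j | j <;> simp at hxy
    · exact hadj i j
    · exact (hadj j i).symm

/-- No spoke of a `K₂,₃` lies in a dense set. -/
theorem Dense.not_K23 (hG : Subcubic G) (hS : Dense G S)
    (hK : ¬ HasMinor G (completeBipartiteGraph (Fin 3) (Fin 3))) {u v a c d : V}
    (h : s(u, v) ∈ S) (hav : a ≠ v) (huc : u ≠ c) (hud : u ≠ d) (hcd : c ≠ d)
    (hua : G.Adj u a) (hvc : G.Adj v c) (hvd : G.Adj v d) (hac : G.Adj a c) (had : G.Adj a d) :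
    False := by
  classical
  obtain ⟨b, hub, hbv, hba, hb⟩ :=
    hS.exists_adj_of_K23 hG h hav huc hud hcd hua hvc hvd hac had
  wlog hbc : G.Adj b c generalizing c d
  · exact this hud huc hcd.symm hvd hvc had hac hb.symm (by tauto)
  have huv := hS.adj h
  by_cases hbd : G.Adj b d
  · exact hK (hasMinor_K33 huc hud hcd hav.symm hbv.symm hba.symm huv hua hub hvc.symm hac.symm
      hbc.symm hvd.symm had.symm hbd.symm)
  have hu : ∀ w, G.Adj u w → w ≠ v → w = a ∨ w = b := fun w hw hwv => by
    have := hG u v a b w huv hua hub hw hav.symm hbv.symm hba.symm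
    tauto
  have hv : ∀ w, G.Adj v w → w ≠ u → w = c ∨ w = d := fun w hw hwu => by
    have := hG v u c d w huv.symm hvc hvd hw huc hud hcd
    tauto
  have hc : ∀ w, G.Adj c w → w ≠ v → w = a ∨ w = b := fun w hw hwv => by
    have := hG c v a b w hvc.symm hac.symm hbc.symm hw hav.symm hbv.symm hba.symm
    tauto
  have ha : ∀ w, G.Adj a w → w ≠ u → w = c ∨ w = d := fun w hw hwu => by
    have := hG a u c d w hua.symm hac had hw huc hud hcd
    tauto
  have hvdS : s(v, d) ∉ S := fun hmem => by
    obtain ⟨x, hdx, hxv, hxa, hx⟩ := hS.exists_adj_of_K23 hG (Sym2.eq_swap ▸ hmem) hav hud.symm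
      hcd.symm huc had.symm huv.symm hvc hua.symm hac
    rcases hx with hx | hx
    · rcases hu x hx.symm hxv with rfl | rfl
      · exact hxa rfl
      · exact hbd hdx.symm
    · rcases hc x hx.symm hxv with rfl | rfl
      · exact hxa rfl
      · exact hbd hdx.symm
  have hubS : s(u, b) ∉ S := fun hmem => by
    obtain ⟨x, hdx, hxv, hxa, hx⟩ := hS.exists_adj_of_K23 (u := b) (v := u) (a := c) (c := v)
      (d := a) hG (Sym2.eq_swap ▸ hmem) huc.symm hbv hba hav.symm hbc huv hua hvc.symm hac.symm
    rcases hx with hx | hx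
    · rcases hv x hx.symm hxv with rfl | rfl
      · exact hxa rfl
      · exact hbd hdx
    · rcases ha x hx.symm hxv with rfl | rfl
      · exact hxa rfl
      · exact hbd hdx
  obtain ⟨f, hfS, hfT, hf⟩ := hS.exists_conflict h hu hv
    {s(u, a), s(v, c), s(a, c), s(a, d), s(b, c)} Finset.card_le_five
  rcases hf with rfl | rfl | rfl | rfl | ⟨h1, rfl⟩ | ⟨h1, rfl⟩ | ⟨h1, rfl⟩ | ⟨h1, rfl⟩ <;>
    first | (exfalso; apply hfT; simp; done) | contradiction

/-- No edge of a triangle lies in a dense set. -/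
theorem Dense.not_triangle (hG : Subcubic G) (hS : Dense G S)
    (hK : ¬ HasMinor G (completeBipartiteGraph (Fin 3) (Fin 3))) {u v w : V}
    (h : s(u, v) ∈ S) (huw : G.Adj u w) (hvw : G.Adj v w) : False := by
  classical
  have huv := hS.adj h
  obtain ⟨b, hub, hbv, hbw, hu⟩ := hS.exists_neighbors hG h huw hvw.ne'
  obtain ⟨d, hvd, hdu, hdw, hv⟩ := hS.exists_neighbors hG (Sym2.eq_swap ▸ h) hvw huw.ne'
  have hbd : b ≠ d := by
    rintro rfl
    obtain ⟨f, hfS, hfT, hf⟩ := hS.exists_conflict h hu hv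
      {s(u, w), s(u, b), s(v, w), s(v, b), s(w, b)} Finset.card_le_five
    rcases hf with rfl | rfl | rfl | rfl | ⟨h1, rfl⟩ | ⟨h1, rfl⟩ | ⟨h1, rfl⟩ | ⟨h1, rfl⟩ <;>
      first | (exfalso; apply hfT; simp; done) | exact h1.ne rfl
  have hw := hG w u v
  have hadj : G.Adj b d := by
    by_contra hn
    obtain ⟨f, hfS, hfT, hf⟩ := hS.exists_conflict h hu hv
      {s(u, w), s(u, b), s(v, w), s(v, d), if G.Adj w d then s(w, d) else s(b, w)}
      Finset.card_le_five
    rcases hf with rfl | rfl | rfl | rfl | ⟨h1, rfl⟩ | ⟨h1, rfl⟩ | ⟨h1, rfl⟩ | ⟨h1, rfl⟩ <;>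
      try (first | (exfalso; apply hfT; simp; done) | exact h1.ne rfl | exact hn h1)
    · simp [h1] at hfT
    · by_cases h2 : G.Adj w d
      · have := hw d b huw.symm hvw.symm h2 h1.symm huv.ne hdu.symm hvd.ne
        rcases this with h | h | h
        · exact hub.ne' h
        · exact hbv h
        · exact hbd h
      · simp [h2] at hfT
  have hwbd : G.Adj w d ∨ G.Adj w b := by
    by_contra! hn
    obtain ⟨f, hfS, hfT, hf⟩ := hS.exists_conflict h hu hv
      {s(u, w), s(u, b), s(v, w), s(v, d), s(b, d)} Finset.card_le_five
    rcases hf with rfl | rfl | rfl | rfl | ⟨h1, rfl⟩ | ⟨h1, rfl⟩ | ⟨h1, rfl⟩ | ⟨h1, rfl⟩ <;>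
      first | (exfalso; apply hfT; simp; done) | exact h1.ne rfl | exact hn.1 h1 | exact hn.2 h1.symm
  rcases hwbd with hwd | hwb
  · exact hS.not_K23 (u := v) (v := u) (a := d) (c := w) (d := b) hG hK (Sym2.eq_swap ▸ h)
      hdu hvw.ne hbv.symm hbw.symm hvd huw hub hwd.symm hadj.symm
  · exact hS.not_K23 (u := u) (v := v) (a := b) (c := w) (d := d) hG hK h
      hbv huw.ne hdu.symm hdw.symm hub hvw hvd hwb.symm hadj

/-- Two adjacent edges, one of them in a dense set, lie in a common 4-cycle within that set. -/
theorem Dense.exists_C4 (hG : Subcubic G) (hS : Dense G S)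
    (hK : ¬ HasMinor G (completeBipartiteGraph (Fin 3) (Fin 3))) {u v a : V}
    (h : s(u, v) ∈ S) (hua : G.Adj u a) (hav : a ≠ v) :
    ∃ c, c ≠ u ∧ G.Adj v c ∧ G.Adj a c ∧ s(u, a) ∈ S ∧ s(v, c) ∈ S ∧ s(a, c) ∈ S := by
  classical
  have huv := hS.adj h
  obtain ⟨b, hub, hbv, hba, hu⟩ := hS.exists_neighbors hG h hua hav
  obtain ⟨d, hvd, hdu, -⟩ := hS.exists_third hG u (Sym2.eq_swap ▸ h : s(v, u) ∈ S)
  obtain ⟨c, hvc, hcu, hcd, hv⟩ := hS.exists_neighbors hG (Sym2.eq_swap ▸ h) hvd hdu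
  -- each of `a`, `b` has at most one neighbor among `c`, `d`, and vice versa
  have h1 : ¬ (G.Adj a c ∧ G.Adj a d) := fun ⟨h1, h2⟩ =>
    hS.not_K23 hG hK h hav hcu.symm hdu.symm hcd hua hvc hvd h1 h2
  have h2 : ¬ (G.Adj b c ∧ G.Adj b d) := fun ⟨h1, h2⟩ =>
    hS.not_K23 hG hK h hbv hcu.symm hdu.symm hcd hub hvc hvd h1 h2
  have h3 : ¬ (G.Adj a c ∧ G.Adj b c) := fun ⟨h1, h2⟩ =>
    hS.not_K23 (u := v) (v := u) (a := c) (c := a) (d := b) hG hK (Sym2.eq_swap ▸ h) hcu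
      hav.symm hbv.symm hba.symm hvc hua hub h1.symm h2.symm
  have h4 : ¬ (G.Adj a d ∧ G.Adj b d) := fun ⟨h1, h2⟩ =>
    hS.not_K23 (u := v) (v := u) (a := d) (c := a) (d := b) hG hK (Sym2.eq_swap ▸ h) hdu
      hav.symm hbv.symm hba.symm hvd hua hub h1.symm h2.symm
  wlog hac : G.Adj a c generalizing c d
  · by_cases had : G.Adj a d
    · exact this c hvc hcu d hvd hdu hcd.symm (fun w hw hwu => (hv w hw hwu).symm)
        (by tauto) (by tauto) h4 h3 had
    · exfalso
      obtain ⟨f, hfS, hfT, hf⟩ := hS.exists_conflict h hu hv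
        {s(u, a), s(u, b), s(v, d), s(v, c), if G.Adj b c then s(b, c) else s(b, d)}
        Finset.card_le_five
      rcases hf with rfl | rfl | rfl | rfl | ⟨h5, rfl⟩ | ⟨h5, rfl⟩ | ⟨h5, rfl⟩ | ⟨h5, rfl⟩ <;>
        try (first | (apply hfT; simp; done) | contradiction)
      · have : ¬ G.Adj b c := fun h6 => h2 ⟨h6, h5⟩
        simp [this] at hfT
      · simp [h5] at hfT
  have hmem : ∀ T : Finset (Sym2 V), T.card ≤ 5 → ∃ f ∈ S, f ∉ T ∧
      (f = s(u, a) ∨ f = s(u, b) ∨ f = s(v, c) ∨ f = s(v, d) ∨ f = s(a, c) ∨ f = s(b, d)) := by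
    intro T hT
    obtain ⟨f, hfS, hfT, hf⟩ := hS.exists_conflict h hu hv T hT
    exact ⟨f, hfS, hfT, by tauto⟩
  refine ⟨c, hcu, hvc, hac, ?_, ?_, ?_⟩
  · obtain ⟨f, hfS, hfT, hf⟩ :=
      hmem {s(u, b), s(v, c), s(v, d), s(a, c), s(b, d)} Finset.card_le_five
    rcases hf with rfl | rfl | rfl | rfl | rfl | rfl <;> simp_all
  · obtain ⟨f, hfS, hfT, hf⟩ :=
      hmem {s(u, a), s(u, b), s(v, d), s(a, c), s(b, d)} Finset.card_le_five
    rcases hf with rfl | rfl | rfl | rfl | rfl | rfl <;> simp_all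
  · obtain ⟨f, hfS, hfT, hf⟩ :=
      hmem {s(u, a), s(u, b), s(v, c), s(v, d), s(b, d)} Finset.card_le_five
    rcases hf with rfl | rfl | rfl | rfl | rfl | rfl <;> simp_all

/-- The neighbors of each vertex of the cube, labelled so that `i` and `7 - i` are antipodal. -/
def cubeNbr : Fin 8 → Fin 3 → Fin 8 :=
  ![![1, 2, 3], ![0, 4, 5], ![0, 4, 6], ![0, 5, 6], ![1, 2, 7], ![1, 3, 7], ![2, 3, 7], ![4, 5, 6]]

/-- The coloring of the edges of the cube in which antipodal edges share a color. -/
def cubeColor : Sym2 (Fin 8) → Fin 6 :=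
  Sym2.lift ⟨![![0, 0, 1, 2, 0, 0, 0, 0], ![0, 0, 0, 0, 3, 5, 0, 0], ![1, 0, 0, 0, 4, 0, 5, 0],
    ![2, 0, 0, 0, 0, 4, 3, 0], ![0, 3, 4, 0, 0, 0, 0, 2], ![0, 5, 0, 4, 0, 0, 0, 1],
    ![0, 0, 5, 3, 0, 0, 0, 0], ![0, 0, 0, 0, 2, 1, 0, 0]], by decide⟩

theorem cubeColor_ne_of_adjacent : ∀ i k l, cubeNbr i k ≠ cubeNbr i l →
    cubeColor s(i, cubeNbr i k) ≠ cubeColor s(i, cubeNbr i l) := by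
  decide

theorem cubeColor_ne_of_opposite : ∀ i k l m, i ≠ cubeNbr (cubeNbr i k) l →
    cubeNbr i k ≠ cubeNbr (cubeNbr (cubeNbr i k) l) m →
    (∃ n, cubeNbr (cubeNbr (cubeNbr (cubeNbr i k) l) m) n = i) →
    cubeColor s(i, cubeNbr i k) ≠
      cubeColor s(cubeNbr (cubeNbr i k) l, cubeNbr (cubeNbr (cubeNbr i k) l) m) := by
  decide +kernel

/-- A dense set of edges meets a cube that is a component of `G`. -/
theorem Dense.exists_cube (hG : Subcubic G) (hS : Dense G S)
    (hK : ¬ HasMinor G (completeBipartiteGraph (Fin 3) (Fin 3))) (hne : S.Nonempty) :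
    ∃ φ : Fin 8 → V, Function.Injective φ ∧
      (∀ i w, G.Adj (φ i) w → ∃ k, w = φ (cubeNbr i k)) ∧ s(φ 0, φ 1) ∈ S := by
  obtain ⟨e, he⟩ := hne
  induction e using Sym2.ind with | _ u x₁
  obtain ⟨x₂, hux₂, hx₂₁, -⟩ := hS.exists_third hG u he
  obtain ⟨x₃, hux₃, hx₃₁, hx₃₂⟩ := hS.exists_third hG x₂ he
  have hux₁ := hS.adj he
  obtain ⟨y₁₂, hy₁₂u, h₁y₁₂, h₂y₁₂, he₂, he₁y₁₂, he₂y₁₂⟩ := hS.exists_C4 hG hK he hux₂ hx₂₁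
  obtain ⟨y₁₃, hy₁₃u, h₁y₁₃, h₃y₁₃, he₃, he₁y₁₃, he₃y₁₃⟩ := hS.exists_C4 hG hK he hux₃ hx₃₁
  obtain ⟨y₂₃, hy₂₃u, h₂y₂₃, h₃y₂₃, -, he₂y₂₃, he₃y₂₃⟩ := hS.exists_C4 hG hK he₂ hux₃ hx₃₂
  have hK23 : ∀ y, y ≠ u → G.Adj x₁ y → G.Adj x₂ y → G.Adj x₃ y → False :=
    fun y hy h1 h2 h3 => hS.not_K23 (u := x₁) (v := u) hG hK (Sym2.eq_swap ▸ he) hy hx₂₁.symm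
      hx₃₁.symm hx₃₂.symm h1 hux₂ hux₃ h2.symm h3.symm
  have hy₁ : y₁₂ ≠ y₁₃ := by
    rintro rfl
    exact hK23 _ hy₁₂u h₁y₁₂ h₂y₁₂ h₃y₁₃
  have hy₂ : y₁₂ ≠ y₂₃ := by
    rintro rfl
    exact hK23 _ hy₁₂u h₁y₁₂ h₂y₁₂ h₃y₂₃
  have hy₃ : y₁₃ ≠ y₂₃ := by
    rintro rfl
    exact hK23 _ hy₁₃u h₁y₁₃ h₂y₂₃ h₃y₁₃
  obtain ⟨z, hz₁, h₁₂z, h₁₃z, -⟩ := hS.exists_C4 hG hK he₁y₁₂ h₁y₁₃ hy₁.symm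
  obtain ⟨z', hz'₂, h₁₂z', h₂₃z', -⟩ := hS.exists_C4 hG hK he₂y₁₂ h₂y₂₃ hy₂.symm
  have hu := fun w hw => hG u x₁ x₂ x₃ w hux₁ hux₂ hux₃ hw hx₂₁.symm hx₃₁.symm hx₃₂.symm
  have h₁ := fun w hw => hG x₁ u y₁₂ y₁₃ w hux₁.symm h₁y₁₂ h₁y₁₃ hw hy₁₂u.symm hy₁₃u.symm hy₁
  have h₂ := fun w hw => hG x₂ u y₁₂ y₂₃ w hux₂.symm h₂y₁₂ h₂y₂₃ hw hy₁₂u.symm hy₂₃u.symm hy₂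
  have h₃ := fun w hw => hG x₃ u y₁₃ y₂₃ w hux₃.symm h₃y₁₃ h₃y₂₃ hw hy₁₃u.symm hy₂₃u.symm hy₃
  have hz₂ : z ≠ x₂ := by
    rintro rfl
    have := h₂ _ h₁₃z.symm
    tauto
  have hz'₁ : z' ≠ x₁ := by
    rintro rfl
    have := h₁ _ h₂₃z'.symm
    tauto
  have h₁₂ := fun w hw =>
    hG y₁₂ x₁ x₂ z w h₁y₁₂.symm h₂y₁₂.symm h₁₂z hw hx₂₁.symm hz₁.symm hz₂.symm
  obtain rfl : z' = z := by
    have := h₁₂ _ h₁₂z'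
    tauto
  have hz₃ : z' ≠ x₃ := by
    rintro rfl
    have := h₃ _ h₁₂z.symm
    tauto
  have h₁₃ := fun w hw =>
    hG y₁₃ x₁ x₃ z' w h₁y₁₃.symm h₃y₁₃.symm h₁₃z hw hx₃₁.symm hz₁.symm hz₃.symm
  have h₂₃ := fun w hw =>
    hG y₂₃ x₂ x₃ z' w h₂y₂₃.symm h₃y₂₃.symm h₂₃z' hw hx₃₂.symm hz₂.symm hz₃.symm
  have hz := fun w hw => hG z' y₁₂ y₁₃ y₂₃ w h₁₂z.symm h₁₃z.symm h₂₃z'.symm hw hy₁ hy₂ hy₃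
  have hxy₁ : x₁ ≠ y₂₃ := by
    rintro rfl
    exact hS.not_triangle hG hK he hux₂ h₂y₂₃.symm
  have hxy₂ : x₂ ≠ y₁₃ := by
    rintro rfl
    exact hS.not_triangle hG hK he hux₂ h₁y₁₃
  have hxy₃ : x₃ ≠ y₁₂ := by
    rintro rfl
    exact hS.not_triangle hG hK he hux₃ h₁y₁₂
  have huz : u ≠ z' := by
    rintro rfl
    rcases hu _ h₁₂z.symm with rfl | rfl | rfl
    · exact h₁y₁₂.ne rfl
    · exact h₂y₁₂.ne rfl
    · exact hxy₃ rfl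
  have hinj : [u, x₁, x₂, x₃, y₁₂, y₁₃, y₂₃, z'].Nodup := by
    simp [hux₁.ne, hux₂.ne, hux₃.ne, hy₁₂u.symm, hy₁₃u.symm, hy₂₃u.symm, huz, hx₂₁.symm,
      hx₃₁.symm, hx₃₂.symm, h₁y₁₂.ne, h₁y₁₃.ne, hxy₁, hz₁.symm, h₂y₁₂.ne, hxy₂, h₂y₂₃.ne, hz₂.symm,
      hxy₃, h₃y₁₃.ne, h₃y₂₃.ne, hz₃.symm, hy₁, hy₂, hy₃, h₁₂z.ne, h₁₃z.ne, h₂₃z'.ne]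
  refine ⟨![u, x₁, x₂, x₃, y₁₂, y₁₃, y₂₃, z'], List.nodup_ofFn.1 (by simpa using hinj),
    fun i w hw => ?_, he⟩
  have nbr : ∀ {ψ : Fin 3 → V}, w = ψ 0 ∨ w = ψ 1 ∨ w = ψ 2 → ∃ k, w = ψ k := by
    rintro ψ (h | h | h)
    exacts [⟨0, h⟩, ⟨1, h⟩, ⟨2, h⟩]
  fin_cases i
  exacts [nbr (hu w hw), nbr (h₁ w hw), nbr (h₂ w hw), nbr (h₃ w hw), nbr (h₁₂ w hw),
    nbr (h₁₃ w hw), nbr (h₂₃ w hw), nbr (hz w hw)]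

/-- A component of `G` that is a cube can be colored independently of the other edges. -/
theorem sixColorable_of_cube {φ : Fin 8 → V} (hφ : Function.Injective φ)
    (hadj : ∀ i w, G.Adj (φ i) w → ∃ k, w = φ (cubeNbr i k)) {S' : Finset (Sym2 V)}
    (hS' : SixColorable G S') (hSS' : ∀ e ∈ S, e ∈ S' ∨ ∀ x ∈ e, x ∈ Set.range φ) :
    SixColorable G S := by
  classical
  obtain ⟨C, hC⟩ := hS'
  have key : ∀ e f, Conflict G e f → (∀ x ∈ e, x ∈ Set.range φ) → (∀ x ∈ f, x ∈ Set.range φ) ∧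
      cubeColor (e.map (Function.invFun φ)) ≠ cubeColor (f.map (Function.invFun φ)) := by
    have hinv : ∀ i, Function.invFun φ (φ i) = i := Function.leftInverse_invFun hφ
    rintro e f (⟨a, b, c, hab, hac, hbc, rfl, rfl⟩ | ⟨a, b, c, d, h, rfl, rfl⟩) he
    · obtain ⟨i, rfl⟩ := he a (by simp)
      obtain ⟨k, rfl⟩ := hadj _ _ hab
      obtain ⟨l, rfl⟩ := hadj _ _ hac
      refine ⟨by simp, ?_⟩
      simp only [Sym2.map_mk, hinv]
      exact cubeColor_ne_of_adjacent i k l (fun h => hbc (congrArg φ h))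
    · obtain ⟨-, hac, -, -, hbd, -, hab, hbc, hcd, hda⟩ := h
      obtain ⟨i, rfl⟩ := he a (by simp)
      obtain ⟨k, rfl⟩ := hadj _ _ hab
      obtain ⟨l, rfl⟩ := hadj _ _ hbc
      obtain ⟨m, rfl⟩ := hadj _ _ hcd
      obtain ⟨n, hn⟩ := hadj _ _ hda
      refine ⟨by simp, ?_⟩
      simp only [Sym2.map_mk, hinv]
      exact cubeColor_ne_of_opposite i k l m (fun h => hac (congrArg φ h))
        (fun h => hbd (congrArg φ h)) ⟨n, (hφ hn).symm⟩
  refine ⟨fun e => if ∀ x ∈ e, x ∈ Set.range φ then cubeColor (e.map (Function.invFun φ)) else C e,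
    fun e he f hf hef => ?_⟩
  by_cases he' : ∀ x ∈ e, x ∈ Set.range φ
  · obtain ⟨hf', hne⟩ := key e f hef he'
    simpa only [if_pos he', if_pos hf'] using hne
  · have hf' : ¬ ∀ x ∈ f, x ∈ Set.range φ := fun hf' => he' (key f e hef.symm hf').1
    simpa only [if_neg he', if_neg hf'] using
      hC e ((hSS' e he).resolve_right he') f ((hSS' f hf).resolve_right hf') hef

theorem sixColorable_of_erase [DecidableEq V] {e : Sym2 V} (hS : SixColorable G (S.erase e))
    {T : Finset (Sym2 V)} (hT : T.card ≤ 5) (hST : ∀ f ∈ S, Conflict G e f → f ∈ T)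
    (he : ¬ Conflict G e e) : SixColorable G S := by
  obtain ⟨C, hC⟩ := hS
  obtain ⟨k, -, hk⟩ : ∃ k ∈ (Finset.univ : Finset (Fin 6)), k ∉ T.image C :=
    Finset.exists_mem_notMem_of_card_lt_card
      (Finset.card_image_le.trans_lt (by simpa using Nat.lt_succ_of_le hT))
  have hk' : ∀ f ∈ S, Conflict G e f → k ≠ C f := fun f hf hef hkf =>
    hk (hkf ▸ Finset.mem_image_of_mem C (hST f hf hef))
  refine ⟨Function.update C e k, fun f hf g hg hfg => ?_⟩
  by_cases hfe : f = e
  · subst hfe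
    have hgf : g ≠ f := by
      rintro rfl
      exact he hfg
    simpa [hgf] using hk' g hg hfg
  · by_cases hge : g = e
    · subst hge
      simpa [hfe] using (hk' f hf hfg.symm).symm
    · simpa [hfe, hge] using hC f (Finset.mem_erase.2 ⟨hfe, hf⟩) g (Finset.mem_erase.2 ⟨hge, hg⟩) hfg

theorem Conflict.ne {e f : Sym2 V} (h : Conflict G e f) : e ≠ f := by
  rcases h with ⟨a, b, c, hab, hac, hbc, rfl, rfl⟩ | ⟨a, b, c, d, h, rfl, rfl⟩
  · exact fun he => hbc (Sym2.congr_right.1 he)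
  · obtain ⟨-, hac, had, -⟩ := h
    simp [hac, had]

theorem sixColorable (hG : Subcubic G)
    (hK : ¬ HasMinor G (completeBipartiteGraph (Fin 3) (Fin 3))) (S : Finset (Sym2 V)) :
    SixColorable G S := by
  classical
  induction S using Finset.strongInduction with | _ S ih
  by_cases hS : Dense G S
  · rcases S.eq_empty_or_nonempty with rfl | hne
    · exact ⟨fun _ => 0, by simp⟩
    obtain ⟨φ, hφ, hadj, hmem⟩ := hS.exists_cube hG hK hne
    refine sixColorable_of_cube hφ hadj
      (ih (S.filter fun e => ¬ ∀ x ∈ e, x ∈ Set.range φ) ?_) fun e he => ?_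
    · exact Finset.filter_ssubset.2 ⟨_, hmem, by simp⟩
    · by_cases h : ∀ x ∈ e, x ∈ Set.range φ
      · exact Or.inr h
      · exact Or.inl (Finset.mem_filter.2 ⟨he, h⟩)
  · unfold Dense at hS
    push Not at hS
    obtain ⟨e, he, T, hT, hST⟩ := hS
    refine sixColorable_of_erase (ih _ (Finset.erase_ssubset he)) hT (fun f hf hef => ?_)
      (fun h => h.ne rfl)
    by_contra hfT
    exact hST f hf hfT hef

end SubcubicBColoring

theorem qB_subcubic_planar_le {V : Type*} [Fintype V] [DecidableEq V] (G : SimpleGraph V)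
    [DecidableRel G.Adj] (hG : IsPlanar G) (hΔ : ∀ v, G.degree v ≤ 3) :
    qB G ≤ 6 := by
  obtain ⟨C, hC⟩ := SubcubicBColoring.sixColorable
    (SubcubicBColoring.subcubic_of_degree_le hΔ) hG.2 Finset.univ
  have hC' : ∀ e f, SubcubicBColoring.Conflict G e f → C e ≠ C f := fun e f =>
    hC e (Finset.mem_univ e) f (Finset.mem_univ f)
  refine Nat.sInf_le ⟨C, fun a b c hab hac hbc => hC' _ _ (Or.inl ⟨a, b, c, hab, hac, hbc, rfl, rfl⟩),
    fun a b c d h => ?_⟩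
  have hopp := hC' _ _ (Or.inr ⟨a, b, c, d, h, rfl, rfl⟩)
  obtain ⟨h1, h2, h3, h4, h5, h6, h7, h8, h9, h10⟩ := h
  have hopp' := hC' _ _ (Or.inr ⟨b, c, d, a,
    ⟨h4, h5, h1.symm, h6, h2.symm, h3.symm, h8, h9, h10, h7⟩, rfl, rfl⟩)
  have hadj : ∀ x y z, G.Adj x y → G.Adj y z → x ≠ z → C s(x, y) ≠ C s(y, z) :=
    fun x y z hxy hyz hxz => by
      rw [Sym2.eq_swap]
      exact hC' _ _ (Or.inl ⟨y, x, z, hxy.symm, hyz, hxz, rfl, rfl⟩)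
  exact ⟨hadj a b c h7 h8 h2, hopp, (hadj d a b h10 h7 h5.symm).symm, hadj b c d h8 h9 h5, hopp',
    hadj c d a h9 h10 h2.symm⟩
end
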